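/- Let p be a prime, G ⊆ SL(3, F_p) a finite subgroup, V = (F_p)³, and let W ⊆ V be a G-submodule with dim_{F_p} W = 2 which is irreducible as a G-module. Then the invariant ring S(V)^G is Gorenstein. -/

import Mathlib

noncomputable section
open CategoryTheory Matrix MvPolynomial

universe u

/-- A module `M` over `R` has finite injective dimension iff the Ext functors
`Ext^i(-, M)` vanish for all sufficiently large `i`. -/
def HasFiniteInjectiveDimension (R : Type u) [CommRing R] (M : ModuleCat.{u} R) : Prop :=
  ∃ n : ℕ, ∀ (N : ModuleCat.{u} R) (i : ℕ), n < i →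
    Subsingleton (((Ext R (ModuleCat.{u} R) i).obj (Opposite.op N)).obj M)

/-- A commutative ring is Gorenstein if it is Noetherian and its localization at every
prime ideal has finite injective dimension over itself. -/
def IsGorensteinRing (R : Type u) [CommRing R] : Prop :=
  IsNoetherianRing R ∧ ∀ (P : Ideal R) [P.IsPrime],
    HasFiniteInjectiveDimension (Localization.AtPrime P)
      (ModuleCat.of (Localization.AtPrime P) (Localization.AtPrime P))

/-- The substitution action of a matrix on polynomials: `X i ↦ ∑ j, M i j • X j`. -/
def polyAct {F : Type u} [CommSemiring F] {m : ℕ} (M : Matrix (Fin m) (Fin m) F) :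
    MvPolynomial (Fin m) F →ₐ[F] MvPolynomial (Fin m) F :=
  MvPolynomial.aeval fun i => ∑ j, M i j • MvPolynomial.X j

/-- The subalgebra of polynomials invariant under a set of matrices. -/
def invariantAlg {F : Type u} [CommSemiring F] {m : ℕ} (S : Set (Matrix (Fin m) (Fin m) F)) :
    Subalgebra F (MvPolynomial (Fin m) F) where
  carrier := {f | ∀ M ∈ S, polyAct M f = f}
  mul_mem' := fun hf hg => fun M hM => by rw [_root_.map_mul, hf M hM, hg M hM]
  add_mem' := fun hf hg => fun M hM => by rw [_root_.map_add, hf M hM, hg M hM]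
  algebraMap_mem' := fun r => fun M hM => (polyAct M).commutes r

/-- The invariant ring `S(V)^G` for a subgroup `G` of `SL(m, F)`, where `S(V)` is realised
as the polynomial ring `F[X 0, …, X (m-1)]`. -/
def invariantRing {F : Type u} [Field F] {m : ℕ}
    (G : Subgroup (Matrix.SpecialLinearGroup (Fin m) F)) :
    Subalgebra F (MvPolynomial (Fin m) F) :=
  invariantAlg {M | ∃ g ∈ G, (g : Matrix (Fin m) (Fin m) F) = M}

/-- A matrix `M` is a transvection if `rank (M - 1) = 1` and `(M - 1)² = 0`. -/
def IsTransvectionMat {F : Type u} [Field F] {m : ℕ} (M : Matrix (Fin m) (Fin m) F) : Prop :=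
  (M - 1).rank = 1 ∧ (M - 1) * (M - 1) = 0

/-- `T(G)`: the subgroup generated by all transvections contained in `G`. -/
def transSubgroup {F : Type u} [Field F] {m : ℕ}
    (G : Subgroup (Matrix.SpecialLinearGroup (Fin m) F)) :
    Subgroup (Matrix.SpecialLinearGroup (Fin m) F) :=
  Subgroup.closure {g | g ∈ G ∧ IsTransvectionMat (g : Matrix (Fin m) (Fin m) F)}

universe v

theorem subsingleton_ext_of_hasInjectiveDimensionLE {R : Type u} [CommRing R]
    (M N : ModuleCat.{u} R) (n i : ℕ)
    [HasInjectiveDimensionLE M n] (hi : n < i) :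
    Subsingleton (((Ext R (ModuleCat.{u} R) i).obj (Opposite.op N)).obj M) := by
  rw [← ModuleCat.isZero_iff_subsingleton]
  let P := projectiveResolution N
  refine Limits.IsZero.of_iso ?_ (P.isoExt i M)
  obtain ⟨i, rfl⟩ : ∃ j, i = j + 1 := ⟨i - 1, by omega⟩
  rw [← HomologicalComplex.exactAt_iff_isZero_homology,
    HomologicalComplex.exactAt_iff' _ i (i + 1) (i + 2) (by simp) (by simp),
    ShortComplex.moduleCat_exact_iff]
  intro x hx
  have h0 : P.extMk (x : P.complex.X (i + 1) ⟶ M) (i + 2) rfl hx = 0 :=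
    Abelian.Ext.eq_zero_of_hasInjectiveDimensionLT _ (n + 1) (by omega)
  obtain ⟨g, hg⟩ := (P.extMk_eq_zero_iff _ _ _ _ i rfl).1 h0
  exact ⟨g, hg⟩

/-- `τ` is a Frobenius form for the ring map `φ : A →+* B`: it is `A`-linear and `B` has finite
families which are dual to each other with respect to the pairing `(s, t) ↦ τ (s * t)`. -/
structure IsFrobeniusForm {A : Type u} {B : Type v} [CommRing A] [CommRing B] (φ : A →+* B)
    (τ : B →+ A) : Prop where
  map_mul : ∀ a b, τ (φ a * b) = a * τ b
  exists_dual : ∃ (ι : Type) (_ : Fintype ι) (b c : ι → B), ∀ s, ∑ i, φ (τ (s * c i)) * b i = s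

section FrobeniusExtension

variable {A R : Type u} [CommRing A] [CommRing R] {φ : A →+* R}

theorem IsFrobeniusForm.projective {τ : R →+ A} (h : IsFrobeniusForm φ τ) :
    Module.Projective A ((ModuleCat.restrictScalars φ).obj (ModuleCat.of R R)) := by
  obtain ⟨ι, _, b, c, hbc⟩ := h.exists_dual
  let N := (ModuleCat.restrictScalars φ).obj (ModuleCat.of R R)
  let i : N →ₗ[A] (ι → A) :=
    { toFun := fun s j => τ ((show R from s) * c j)
      map_add' := fun x y => by
        funext j
        exact (congrArg τ (add_mul (R := R) _ _ _)).trans (map_add τ _ _)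
      map_smul' := fun a x => by
        funext j
        exact (congrArg τ (mul_assoc (φ a) (show R from x) (c j))).trans (h.map_mul _ _) }
  let s : (ι → A) →ₗ[A] N := Fintype.linearCombination A (M := N) b
  refine Module.Projective.of_split i s ?_
  ext x
  simp only [s, i, LinearMap.comp_apply]
  exact hbc x

theorem hasInjectiveDimensionLE_coextend
    [hp : Module.Projective A ((ModuleCat.restrictScalars φ).obj (ModuleCat.of R R))]
    (n : ℕ) (M : ModuleCat.{u} A) [hM : HasInjectiveDimensionLE M n] :
    HasInjectiveDimensionLE ((ModuleCat.coextendScalars.{u,u,u} φ).obj M) n := by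
  induction n generalizing M with
  | zero =>
    simp only [HasInjectiveDimensionLE, zero_add,
      ← injective_iff_hasInjectiveDimensionLT_one] at hM ⊢
    exact Injective.injective_of_adjoint (ModuleCat.restrictCoextendScalarsAdj φ) M
  | succ n ih =>
    obtain ⟨I, inj, f, monof⟩ := (inferInstance : EnoughInjectives (ModuleCat.{u} A)).1 M
    let T := ShortComplex.mk f (Limits.cokernel.π f) (Limits.cokernel.condition f)
    have T_exact : T.ShortExact := { exact := ShortComplex.exact_cokernel f }
    have hex : Function.Exact (ConcreteCategory.hom T.f) (ConcreteCategory.hom T.g) :=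
      (ShortComplex.ShortExact.moduleCat_exact_iff_function_exact _).mp T_exact.1
    have hinj : Function.Injective T.f.hom := (ModuleCat.mono_iff_injective f).mp monof
    have hsurj : Function.Surjective T.g.hom := (ModuleCat.epi_iff_surjective _).mp T_exact.epi_g
    let TS := T.map (ModuleCat.coextendScalars.{u,u,u} φ)
    have TS_exact : TS.ShortExact := by
      have hmono : Mono TS.f :=
        have := (ModuleCat.restrictCoextendScalarsAdj.{u,u,u} φ).isRightAdjoint
        have : Mono T.f := monof
        (inferInstance : Mono ((ModuleCat.coextendScalars.{u,u,u} φ).map T.f))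
      apply ModuleCat.shortComplex_shortExact
      · intro y
        constructor
        · intro hy
          have hy' : ∀ s : R, T.g.hom (ModuleCat.CoextendScalars.equiv φ _ y s) = 0 := by
            intro s
            exact DFunLike.congr_fun (congrArg (ModuleCat.CoextendScalars.equiv φ _) hy) s
          have hy2 : ∀ s, ∃ m, T.f.hom m = ModuleCat.CoextendScalars.equiv φ _ y s :=
            fun s => (hex _).1 (hy' s)
          have hr : LinearMap.range (ModuleCat.CoextendScalars.equiv φ _ y) ≤
              LinearMap.range T.f.hom := by
            rintro _ ⟨s, rfl⟩
            exact hy2 s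
          let e := LinearEquiv.ofInjective T.f.hom hinj
          let g : (ModuleCat.restrictScalars φ).obj (ModuleCat.of R R) →ₗ[A] T.X₁ :=
            e.symm.toLinearMap ∘ₗ (ModuleCat.CoextendScalars.equiv φ _ y).codRestrict _
              fun s => hr ⟨s, rfl⟩
          refine ⟨(ModuleCat.CoextendScalars.equiv φ _).symm g, ?_⟩
          apply ModuleCat.CoextendScalars.ext
          ext s
          change T.f.hom (g s) = _
          have := e.apply_symm_apply ⟨_, hr ⟨s, rfl⟩⟩
          exact congrArg Subtype.val this
        · rintro ⟨x, rfl⟩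
          exact DFunLike.congr_fun (congrArg ConcreteCategory.hom TS.zero) x
      · exact (ModuleCat.mono_iff_injective _).mp hmono
      · intro y
        obtain ⟨g, hg⟩ := Module.projective_lifting_property T.g.hom
          (ModuleCat.CoextendScalars.equiv φ _ y) hsurj
        refine ⟨(ModuleCat.CoextendScalars.equiv φ _).symm g, ?_⟩
        apply ModuleCat.CoextendScalars.ext
        ext s
        exact DFunLike.congr_fun hg s
    have h3 := (T_exact.hasInjectiveDimensionLT_X₃_iff n inj).mpr hM
    have : Injective TS.X₂ :=
      Injective.injective_of_adjoint (ModuleCat.restrictCoextendScalarsAdj φ) I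
    exact (TS_exact.hasInjectiveDimensionLT_X₃_iff n ‹_›).mp (ih T.X₃)

/-- A Frobenius form identifies `R` with the coextension of scalars of `A`. -/
def IsFrobeniusForm.coextendEquiv {τ : R →+ A} (h : IsFrobeniusForm φ τ) :
    R ≃ₗ[R] (ModuleCat.coextendScalars.{u,u,u} φ).obj (ModuleCat.of A A) := by
  let F : R → ((ModuleCat.restrictScalars φ).obj (ModuleCat.of R R) →ₗ[A] (ModuleCat.of A A)) :=
    fun s =>
    { toFun := fun t => τ ((show R from t) * s)
      map_add' := fun x y => (congrArg τ (add_mul (R := R) _ _ _)).trans (map_add τ _ _)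
      map_smul' := fun a x =>
        (congrArg τ (mul_assoc (φ a) (show R from x) s)).trans (h.map_mul _ _) }
  let G : R →ₗ[R] (ModuleCat.coextendScalars.{u,u,u} φ).obj (ModuleCat.of A A) :=
    { toFun := fun s => (ModuleCat.CoextendScalars.equiv φ _).symm (F s)
      map_add' := fun x y => by
        apply ModuleCat.CoextendScalars.ext
        ext t
        exact (congrArg τ (mul_add (R := R) _ _ _)).trans (map_add τ _ _)
      map_smul' := fun r x => by
        apply ModuleCat.CoextendScalars.ext
        ext t
        change τ ((show R from t) * (r * x)) = τ ((show R from t) * r * x)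
        rw [mul_assoc] }
  refine LinearEquiv.ofBijective G ⟨?_, ?_⟩
  · rw [← LinearMap.ker_eq_bot, LinearMap.ker_eq_bot']
    intro s hs
    obtain ⟨ι, _, b, c, hbc⟩ := h.exists_dual
    have hs' : ∀ t, τ (t * s) = 0 := fun t => by
      have := congrArg (ModuleCat.CoextendScalars.equiv φ _) hs
      exact DFunLike.congr_fun this t
    rw [← hbc s]
    exact Finset.sum_eq_zero fun i _ => by rw [mul_comm s, hs', map_zero, zero_mul]
  · intro y
    obtain ⟨ι, _, b, c, hbc⟩ := h.exists_dual
    let Y := ModuleCat.CoextendScalars.equiv φ _ y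
    refine ⟨∑ i, φ (show A from Y (b i)) * c i, ?_⟩
    apply ModuleCat.CoextendScalars.ext
    ext t
    change τ ((show R from t) * ∑ i, φ (show A from Y (b i)) * c i) = Y t
    have h2 : Y t = ∑ i, τ ((show R from t) * c i) * (show A from Y (b i)) := by
      have : (show (ModuleCat.restrictScalars φ).obj (ModuleCat.of R R) from t)
        = ∑ i, (τ ((show R from t) * c i)) •
            (show (ModuleCat.restrictScalars φ).obj (ModuleCat.of R R) from b i) :=
        (hbc t).symm
      exact (congrArg Y this).trans ((map_sum Y _ _).trans
        (Finset.sum_congr rfl fun i _ => Y.map_smul _ _))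
    rw [h2, Finset.mul_sum, map_sum]
    refine Finset.sum_congr rfl fun i _ => ?_
    rw [mul_left_comm, h.map_mul, mul_comm]

theorem IsFrobeniusForm.hasInjectiveDimensionLE {τ : R →+ A} (h : IsFrobeniusForm φ τ) (n : ℕ)
    [HasInjectiveDimensionLE (ModuleCat.of A A) n] :
    HasInjectiveDimensionLE (ModuleCat.of R R) n := by
  have := h.projective
  have := hasInjectiveDimensionLE_coextend (φ := φ) n (ModuleCat.of A A)
  exact (ModuleCat.hasInjectiveDimensionLE_iff_of_linearEquiv h.coextendEquiv n).2 this

theorem IsFrobeniusForm.isNoetherianRing [IsNoetherianRing A] {τ : R →+ A}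
    (h : IsFrobeniusForm φ τ) : IsNoetherianRing R := by
  obtain ⟨ι, _, b, c, hbc⟩ := h.exists_dual
  let := φ.toAlgebra
  have : Module.Finite A R := by
    refine ⟨Submodule.fg_def.2 ⟨Set.range b, Set.finite_range b, ?_⟩⟩
    rw [eq_top_iff]
    rintro s -
    rw [← hbc s]
    refine Submodule.sum_mem _ fun i _ => ?_
    exact Submodule.smul_mem _ (τ (s * c i)) (Submodule.subset_span ⟨i, rfl⟩)
  exact IsNoetherianRing.of_finite A R

theorem hasInjectiveDimensionLE_localization [IsNoetherianRing R] (n : ℕ)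
    [HasInjectiveDimensionLE (ModuleCat.of R R) n] (S : Submonoid R) :
    HasInjectiveDimensionLE (ModuleCat.of (Localization S) (Localization S)) n := by
  have h := ModuleCat.localizedModule_hasInjectiveDimensionLE n S (ModuleCat.of R R)
  have := ModuleCat.localizedModule_isLocalizedModule (ModuleCat.of R R) S
  let e : (ModuleCat.of R R).localizedModule S ≃ₗ[R] Localization S :=
    IsLocalizedModule.linearEquiv S ((ModuleCat.of R R).localizedModuleMkLinearMap S)
      (Algebra.linearMap R (Localization S))
  let e' := LinearEquiv.extendScalarsOfIsLocalization S (Localization S) e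
  exact (ModuleCat.hasInjectiveDimensionLE_iff_of_linearEquiv e' n).1 h

end FrobeniusExtension

theorem hasInjectiveDimensionLE_zero_of_field (F : Type u) [Field F] (M : ModuleCat.{u} F) :
    HasInjectiveDimensionLE M 0 := by
  simp only [HasInjectiveDimensionLE, zero_add, ← injective_iff_hasInjectiveDimensionLT_one]
  have : Module.Injective F M := by
    refine ⟨fun X Y _ _ _ _ f hf g => ?_⟩
    obtain ⟨h, hh⟩ := LinearMap.exists_leftInverse_of_injective f (LinearMap.ker_eq_bot.2 hf)
    exact ⟨g ∘ₗ h, fun x => congrArg g (LinearMap.congr_fun hh x)⟩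
  exact Module.injective_object_of_injective_module F M

open Polynomial in
theorem hasInjectiveDimensionLE_polynomial (K : Type u) [CommRing K] (d : ℕ)
    (hK : ∀ M : ModuleCat.{u} K, HasInjectiveDimensionLE M d) (N : ModuleCat.{u} K[X]) :
    HasInjectiveDimensionLE N (d + 1) := by
  let φ : K →+* K[X] := Polynomial.C
  have hp : Module.Projective K ((ModuleCat.restrictScalars φ).obj (ModuleCat.of K[X] K[X])) := by
    have : Module.Projective K K[X] := inferInstance
    refine this.of_equiv (show K[X] ≃ₗ[K]
        (ModuleCat.restrictScalars φ).obj (ModuleCat.of K[X] K[X]) from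
      { AddEquiv.refl _ with map_smul' := fun a x => smul_eq_C_mul a })
  let NK := (ModuleCat.restrictScalars φ).obj N
  let H := (ModuleCat.coextendScalars.{u,u,u} φ).obj NK
  have := hK NK
  have hH : HasInjectiveDimensionLE H d := hasInjectiveDimensionLE_coextend d NK
  let ev : H → K[X] →+ N := fun h => (ModuleCat.CoextendScalars.equiv φ _ h).toAddMonoidHom
  have ev_C : ∀ h a f, ev h (Polynomial.C a * f) = (Polynomial.C a : K[X]) • ev h f := fun h a f =>
    (ModuleCat.CoextendScalars.equiv φ _ h).map_smul a f
  have ev_ext : ∀ h h', (∀ f, ev h f = ev h' f) → h = h' := fun h h' hh => by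
    apply ModuleCat.CoextendScalars.ext
    ext t
    exact hh t
  let mk : (e : K[X] →+ N) → (∀ a f, e (Polynomial.C a * f) = (Polynomial.C a : K[X]) • e f) → H :=
    fun e he =>
    (ModuleCat.CoextendScalars.equiv φ _).symm
        { toFun := e, map_add' := e.map_add, map_smul' := he }
  have ev_mk : ∀ e he f, ev (mk e he) f = e f := fun e he f => rfl
  have ev_add : ∀ h h' f, ev (h + h') f = ev h f + ev h' f := fun _ _ _ => rfl
  have ev_smul : ∀ (r : K[X]) h f, ev (r • h) f = ev h (f * r) := fun _ _ _ => rfl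
  clear_value ev mk
  let i : N →ₗ[K[X]] H :=
    { toFun := fun n => mk (AddMonoidHom.mk' (fun f => f • n) fun f g => add_smul f g n)
        (by simp [mul_smul])
      map_add' := fun x y => ev_ext _ _ fun t => by
        rw [ev_add, ev_mk, ev_mk, ev_mk]
        exact smul_add t x y
      map_smul' := fun r x => ev_ext _ _ fun t => by
        rw [RingHom.id_apply, ev_smul, ev_mk, ev_mk]
        exact (mul_smul t r x).symm }
  let D : H →ₗ[K[X]] H :=
    { toFun := fun h => mk
        (AddMonoidHom.mk' (fun f => ev h (Polynomial.X * f) - (Polynomial.X : K[X]) • ev h f)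
          fun f g => by simp only [mul_add, map_add, smul_add]; abel)
        fun a f => by
          simp only [AddMonoidHom.mk'_apply]
          rw [mul_left_comm, ev_C, ev_C, smul_sub, smul_comm]
      map_add' := fun x y => ev_ext _ _ fun t => by
        simp only [ev_add, ev_mk, AddMonoidHom.mk'_apply, smul_add]; abel
      map_smul' := fun r x => ev_ext _ _ fun t => by
        simp [ev_smul, ev_mk, mul_assoc] }
  have hi : ∀ n f, ev (i n) f = f • n := fun n f => ev_mk _ _ _
  have hD : ∀ h f, ev (D h) f = ev h (Polynomial.X * f) - (Polynomial.X : K[X]) • ev h f :=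
    fun n f => ev_mk _ _ _
  clear_value i D
  have hexact : Function.Exact i D := by
    intro h
    constructor
    · intro h0
      have h1 : ∀ f, ev h (Polynomial.X * f) = (Polynomial.X : K[X]) • ev h f := fun f => by
        rw [← sub_eq_zero, ← hD, h0]
        have := ev_smul 0 0 f
        simpa using this
      refine ⟨ev h 1, ev_ext _ _ fun f => ?_⟩
      rw [hi]
      induction f using Polynomial.induction_on with
      | C a => rw [← mul_one (Polynomial.C a), ev_C, mul_one]
      | add p q hp hq => rw [map_add, add_smul, hp, hq]
      | monomial n a ih =>
        have : (Polynomial.C a * Polynomial.X ^ (n + 1) : K[X]) =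
            Polynomial.X * (Polynomial.C a * Polynomial.X ^ n) := by ring
        rw [this, h1, ← ih, mul_smul]
    · rintro ⟨n, rfl⟩
      refine ev_ext _ _ fun f => ?_
      have := ev_smul 0 0 f
      rw [hD, hi, hi, mul_smul, sub_self]
      simpa using this.symm
  have hsurj : Function.Surjective D := by
    intro h
    let s : ℕ → N := fun n =>
      Nat.rec 0 (fun n x => (Polynomial.X : K[X]) • x + ev h (Polynomial.X ^ n)) n
    let e : K[X] →+ N := AddMonoidHom.mk'
        (fun f => f.sum fun n a => (Polynomial.C a : K[X]) • s n) fun f g => by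
      rw [Polynomial.sum_add_index]
      · intro i; simp
      · intro i a b; rw [Polynomial.C_add, add_smul]
    have he : ∀ n a, e (Polynomial.C a * Polynomial.X ^ n) = (Polynomial.C a : K[X]) • s n :=
        fun n a => by
      simp only [e, AddMonoidHom.mk'_apply]
      rw [Polynomial.C_mul_X_pow_eq_monomial, sum_monomial_index _ _ (by simp)]
    refine ⟨mk e fun a f => ?_, ev_ext _ _ fun f => ?_⟩
    · induction f using Polynomial.induction_on' with
      | add p q hp hq => rw [mul_add, map_add, map_add, smul_add, hp, hq]
      | monomial n b =>
        rw [← Polynomial.C_mul_X_pow_eq_monomial, ← mul_assoc, ← Polynomial.C_mul, he, he,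
          Polynomial.C_mul, mul_smul]
    · rw [hD, ev_mk, ev_mk]
      induction f using Polynomial.induction_on' with
      | add p q hp hq =>
        rw [mul_add, map_add, map_add, map_add, smul_add, ← hp, ← hq]
        abel
      | monomial n b =>
        rw [← Polynomial.C_mul_X_pow_eq_monomial, ev_C, mul_left_comm, ← pow_succ', he, he]
        change Polynomial.C b • ((Polynomial.X : K[X]) • s n + ev h (Polynomial.X ^ n)) - _ = _
        rw [smul_add, smul_comm]; abel
  have hinj : Function.Injective i := fun x y hxy => by
    have := congrArg (fun h => ev h 1) hxy
    simpa [hi] using this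
  let T : ShortComplex (ModuleCat.{u} K[X]) :=
      ShortComplex.mk (ModuleCat.ofHom i) (ModuleCat.ofHom D) (by
    apply ModuleCat.hom_ext
    refine LinearMap.ext fun n => ?_
    exact hexact.apply_apply_eq_zero n)
  have hT : T.ShortExact := ModuleCat.shortComplex_shortExact T hexact hinj hsurj
  have : HasInjectiveDimensionLT T.X₂ (d + 2) :=
    hasInjectiveDimensionLT_of_ge H (d + 1) (d + 2) (by omega)
  exact hT.hasInjectiveDimensionLT_X₁ (d + 1) hH this

theorem hasInjectiveDimensionLE_of_ringEquiv {K L : Type u} [CommRing K] [CommRing L] (e : K ≃+* L)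
    (d : ℕ) (hK : ∀ M : ModuleCat.{u} K, HasInjectiveDimensionLE M d) (N : ModuleCat.{u} L) :
    HasInjectiveDimensionLE N d := by
  have hN := hK ((ModuleCat.restrictScalars e.toRingHom).obj N)
  have := RingHomInvPair.of_ringEquiv e
  have := RingHomInvPair.of_ringEquiv e.symm
  let f : ((ModuleCat.restrictScalars e.toRingHom).obj N) ≃ₛₗ[(e : K →+* L)] N :=
    { AddEquiv.refl N with map_smul' := fun a x => rfl }
  exact (ModuleCat.hasInjectiveDimensionLE_iff_of_semiLinearEquiv e f d).1 hN

theorem hasInjectiveDimensionLE_mvPolynomial (F : Type u) [Field F] (n : ℕ)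
    (N : ModuleCat.{u} (MvPolynomial (Fin n) F)) :
    HasInjectiveDimensionLE N n := by
  induction n with
  | zero =>
    exact hasInjectiveDimensionLE_of_ringEquiv
      (MvPolynomial.isEmptyAlgEquiv F (Fin 0)).symm.toRingEquiv 0
      (hasInjectiveDimensionLE_zero_of_field F) N
  | succ n ih =>
    exact hasInjectiveDimensionLE_of_ringEquiv (MvPolynomial.finSuccEquiv F n).symm.toRingEquiv _
      (hasInjectiveDimensionLE_polynomial _ n ih) N

/-- A ring admitting a Frobenius form over a polynomial ring over a field is Gorenstein. -/
theorem IsFrobeniusForm.isGorensteinRing {F R : Type u} [Field F] [CommRing R] {n : ℕ}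
    {φ : MvPolynomial (Fin n) F →+* R} {τ : R →+ MvPolynomial (Fin n) F}
    (h : IsFrobeniusForm φ τ) : IsGorensteinRing R := by
  have := hasInjectiveDimensionLE_mvPolynomial F n (ModuleCat.of _ (MvPolynomial (Fin n) F))
  have hR := h.isNoetherianRing
  have := h.hasInjectiveDimensionLE n
  refine ⟨hR, fun P _ => ⟨n, fun N i hi => ?_⟩⟩
  have := hasInjectiveDimensionLE_localization (R := R) n P.primeCompl
  exact subsingleton_ext_of_hasInjectiveDimensionLE _ N n i hi

section FrobeniusForms

theorem IsFrobeniusForm.comp {A B C : Type*} [CommRing A] [CommRing B] [CommRing C]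
    {φ : A →+* B} {τ : B →+ A} {ψ : B →+* C} {σ : C →+ B}
    (hψ : IsFrobeniusForm ψ σ) (hφ : IsFrobeniusForm φ τ) :
    IsFrobeniusForm (ψ.comp φ) (τ.comp σ) := by
  obtain ⟨ι, _, b, c, h⟩ := hφ.exists_dual
  obtain ⟨κ, _, b', c', h'⟩ := hψ.exists_dual
  refine ⟨fun a s => by simp [hψ.map_mul, hφ.map_mul], κ × ι, inferInstance,
    fun i => ψ (b i.2) * b' i.1, fun i => ψ (c i.2) * c' i.1, fun s => ?_⟩
  rw [Fintype.sum_prod_type]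
  refine Eq.trans (Finset.sum_congr rfl fun j _ => ?_) (h' s)
  conv_rhs => rw [← h (σ (s * c' j)), map_sum, Finset.sum_mul]
  refine Finset.sum_congr rfl fun i _ => ?_
  have : s * (ψ (c i) * c' j) = ψ (c i) * (s * c' j) := by ring
  simp [this, hψ.map_mul, mul_assoc, mul_comm (c i)]

theorem IsFrobeniusForm.of_ringEquiv {A B B' : Type*} [CommRing A] [CommRing B] [CommRing B']
    {φ : A →+* B} {τ : B →+ A} (h : IsFrobeniusForm φ τ) (e : B ≃+* B') :
    IsFrobeniusForm ((e : B →+* B').comp φ) (τ.comp (e.symm : B' →+ B)) := by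
  obtain ⟨ι, _, b, c, hbc⟩ := h.exists_dual
  refine ⟨fun a s => by simp [h.map_mul], ι, inferInstance, e ∘ b, e ∘ c, fun s => ?_⟩
  apply e.symm.injective
  simpa using hbc (e.symm s)

/-- Frobenius forms restrict along retractions which preserve the form. -/
theorem IsFrobeniusForm.retract {A B R : Type*} [CommRing A] [CommRing B] [CommRing R]
    {φ : A →+* B} {τ : B →+ A} (h : IsFrobeniusForm φ τ) (j : R →+* B) (ρ : B →+ R)
    (hρ : ∀ r b, ρ (j r * b) = r * ρ b) (hρ1 : ρ 1 = 1) (hτ : ∀ b, τ (j (ρ b)) = τ b)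
    {φ' : A →+* R} (hφ : ∀ a, j (φ' a) = φ a) :
    IsFrobeniusForm φ' (τ.comp (j : R →+ B)) := by
  obtain ⟨ι, _, b, c, hbc⟩ := h.exists_dual
  refine ⟨fun a s => by simp [hφ, h.map_mul], ι, inferInstance, ρ ∘ b, ρ ∘ c, fun r => ?_⟩
  have hr : ρ (j r) = r := by simpa [hρ1] using hρ r 1
  conv_rhs => rw [← hr, ← hbc (j r), map_sum]
  refine Finset.sum_congr rfl fun i _ => ?_
  rw [← hφ, hρ]
  congr 2
  have := hτ (j r * c i)
  rw [hρ] at this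
  exact this

theorem IsFrobeniusForm.nondegenerate {A B : Type*} [CommRing A] [CommRing B]
    {φ : A →+* B} {τ : B →+ A} (h : IsFrobeniusForm φ τ) {u v : B}
    (huv : ∀ s, τ (s * u) = τ (s * v)) : u = v := by
  obtain ⟨ι, _, b, c, hbc⟩ := h.exists_dual
  rw [← hbc u, ← hbc v]
  refine Finset.sum_congr rfl fun i _ => ?_
  rw [mul_comm u, mul_comm v, huv]

theorem IsFrobeniusForm.exists_mul {A B : Type*} [CommRing A] [CommRing B]
    {φ : A →+* B} {τ : B →+ A} (h : IsFrobeniusForm φ τ) (σ : B →+ A)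
    (hσ : ∀ a b, σ (φ a * b) = a * σ b) : ∃ u, ∀ s, σ s = τ (s * u) := by
  obtain ⟨ι, _, b, c, hbc⟩ := h.exists_dual
  refine ⟨∑ i, φ (σ (b i)) * c i, fun s => ?_⟩
  conv_lhs => rw [← hbc s]
  simp only [map_sum, Finset.mul_sum, hσ]
  refine Finset.sum_congr rfl fun i _ => ?_
  rw [mul_left_comm, h.map_mul, mul_comm]

theorem IsFrobeniusForm.exists_isUnit {A B : Type*} [CommRing A] [CommRing B]
    {φ : A →+* B} {τ : B →+ A} (h : IsFrobeniusForm φ τ) (γ γ' : B →+* B)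
    (h1 : ∀ b, γ (γ' b) = b) (h1' : ∀ b, γ' (γ b) = b)
    (h2 : ∀ a, γ (φ a) = φ a) (h3 : ∀ a, γ' (φ a) = φ a) :
    ∃ u, IsUnit u ∧ ∀ s, τ (γ s) = τ (s * u) := by
  obtain ⟨u, hu⟩ := h.exists_mul (τ.comp (γ : B →+ B)) fun a b => by simp [h2, h.map_mul]
  obtain ⟨v, hv⟩ := h.exists_mul (τ.comp (γ' : B →+ B)) fun a b => by simp [h3, h.map_mul]
  have hu' : ∀ s, τ (γ s) = τ (s * u) := hu
  have hv' : ∀ s, τ (γ' s) = τ (s * v) := hv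
  have huv : γ u * v = 1 := h.nondegenerate fun s => by
    rw [mul_one, ← mul_assoc, ← hv', _root_.map_mul, h1', ← hu', h1]
  have := congrArg γ' huv
  rw [_root_.map_mul, h1', map_one] at this
  exact ⟨u, IsUnit.of_mul_eq_one _ this, hu'⟩

theorem IsFrobeniusForm.injective {A B : Type*} [CommRing A] [CommRing B]
    {φ : A →+* B} {τ : B →+ A} (h : IsFrobeniusForm φ τ) {m : B} (hm : τ m = 1) :
    Function.Injective φ := fun a b hab => by
  have := congrArg (fun x => τ (x * m)) hab
  simpa [h.map_mul, hm] using this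

end FrobeniusForms

section AdjoinRoot

variable {A : Type*} [CommRing A] [Nontrivial A] {f : Polynomial A}

theorem adjoinRoot_coeff_root_mul (hf : f.Monic) (hn : 0 < f.natDegree) (s : AdjoinRoot f) (j : ℕ) :
    (AdjoinRoot.modByMonicHom hf (AdjoinRoot.root f * s)).coeff (j + 1) =
      (AdjoinRoot.modByMonicHom hf s).coeff j
        - (AdjoinRoot.modByMonicHom hf s).coeff (f.natDegree - 1) * f.coeff (j + 1) := by
  obtain ⟨g, rfl⟩ := AdjoinRoot.mk_surjective s
  set r := AdjoinRoot.modByMonicHom hf (AdjoinRoot.mk f g) with hr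
  have hs : AdjoinRoot.mk f g = AdjoinRoot.mk f r := (AdjoinRoot.mk_leftInverse hf _).symm
  have hdeg : r.degree < f.degree := by
    rw [hr, AdjoinRoot.modByMonicHom_mk]
    exact Polynomial.degree_modByMonic_lt g hf
  rw [hs, ← AdjoinRoot.mk_X, ← map_mul, AdjoinRoot.modByMonicHom_mk]
  have key := Polynomial.div_modByMonic_unique (f := Polynomial.X * r) (g := f)
    (Polynomial.C (r.coeff (f.natDegree - 1)))
    (Polynomial.X * r - Polynomial.C (r.coeff (f.natDegree - 1)) * f) hf ⟨by ring, by
      rw [Polynomial.degree_eq_natDegree hf.ne_zero, Polynomial.degree_lt_iff_coeff_zero]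
      intro k hk
      obtain ⟨k, rfl⟩ : ∃ l, k = l + 1 := ⟨k - 1, by omega⟩
      rw [Polynomial.degree_eq_natDegree hf.ne_zero, Polynomial.degree_lt_iff_coeff_zero] at hdeg
      rw [Polynomial.coeff_sub, Polynomial.coeff_X_mul, Polynomial.coeff_C_mul]
      rcases hk.eq_or_lt with h | h
      · rw [← h, hf.coeff_natDegree, h, Nat.add_sub_cancel]; simp
      · rw [hdeg k (by omega), Polynomial.coeff_eq_zero_of_natDegree_lt h]; simp⟩
  rw [key.2, Polynomial.coeff_sub, Polynomial.coeff_X_mul, Polynomial.coeff_C_mul]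

/-- The top coefficient is a Frobenius form for a simple monic extension. -/
theorem adjoinRoot_isFrobeniusForm (hf : f.Monic) (hn : 0 < f.natDegree) :
    ∃ τ : AdjoinRoot f →+ A, IsFrobeniusForm (AdjoinRoot.of f) τ ∧
      τ (AdjoinRoot.root f ^ (f.natDegree - 1)) = 1 := by
  let τ : AdjoinRoot f →+ A := AddMonoidHom.mk'
    (fun s => (AdjoinRoot.modByMonicHom hf s).coeff (f.natDegree - 1)) (by simp)
  have hτ : ∀ s, τ s = (AdjoinRoot.modByMonicHom hf s).coeff (f.natDegree - 1) := fun _ => rfl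
  have hc : ∀ k, k < f.natDegree → ∃ c, ∀ s,
      (AdjoinRoot.modByMonicHom hf s).coeff (f.natDegree - 1 - k) = τ (s * c) := by
    intro k hk
    induction k with
    | zero => exact ⟨1, fun s => by simp [hτ]⟩
    | succ k ih =>
      obtain ⟨c, hc⟩ := ih (by omega)
      refine ⟨AdjoinRoot.root f * c + AdjoinRoot.of f (f.coeff (f.natDegree - 1 - k)), fun s => ?_⟩
      have h1 := adjoinRoot_coeff_root_mul hf hn s (f.natDegree - 1 - (k + 1))
      have h2 : f.natDegree - 1 - (k + 1) + 1 = f.natDegree - 1 - k := by omega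
      rw [h2, hc, ← hτ] at h1
      have h3 : τ (s * AdjoinRoot.of f (f.coeff (f.natDegree - 1 - k)))
          = τ s * f.coeff (f.natDegree - 1 - k) := by
        rw [mul_comm, ← AdjoinRoot.algebraMap_eq, ← Algebra.smul_def, hτ, hτ, map_smul,
          Polynomial.coeff_smul, smul_eq_mul, mul_comm]
      rw [mul_add, map_add, h3, mul_left_comm, ← mul_assoc, h1]
      ring
  have hc' : ∀ k : Fin f.natDegree, ∃ c, ∀ s,
      (AdjoinRoot.modByMonicHom hf s).coeff k = τ (s * c) := fun k => by
    obtain ⟨c, hc⟩ := hc (f.natDegree - 1 - k) (by omega)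
    exact ⟨c, fun s => by rw [← hc]; congr 1; omega⟩
  choose c hc using hc'
  refine ⟨τ, ⟨fun a s => ?_, Fin f.natDegree, inferInstance, fun k => AdjoinRoot.root f ^ (k : ℕ),
    c, fun s => ?_⟩, ?_⟩
  · rw [← AdjoinRoot.algebraMap_eq, ← Algebra.smul_def, hτ, hτ, map_smul,
      Polynomial.coeff_smul, smul_eq_mul]
  · simp only [← hc]
    conv_rhs => rw [← AdjoinRoot.mk_leftInverse hf s]
    have hlt : (AdjoinRoot.modByMonicHom hf s).natDegree < f.natDegree := by
      obtain ⟨g, rfl⟩ := AdjoinRoot.mk_surjective s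
      rw [AdjoinRoot.modByMonicHom_mk]
      exact Polynomial.natDegree_modByMonic_lt g hf fun h => by simp [h] at hn
    conv_rhs => rw [Polynomial.as_sum_range' _ _ hlt]
    rw [Fin.sum_univ_eq_sum_range
      (fun k => (AdjoinRoot.of f) (((AdjoinRoot.modByMonicHom hf) s).coeff k) * AdjoinRoot.root f ^ k),
      map_sum]
    refine Finset.sum_congr rfl fun k _ => ?_
    rw [← Polynomial.C_mul_X_pow_eq_monomial, map_mul, map_pow, AdjoinRoot.mk_X, AdjoinRoot.mk_C]
  · rw [hτ, ← AdjoinRoot.mk_X, ← map_pow, AdjoinRoot.modByMonicHom_mk,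
      (Polynomial.modByMonic_eq_self_iff hf).2]
    · simp
    · rw [Polynomial.degree_X_pow, Polynomial.degree_eq_natDegree hf.ne_zero]
      exact_mod_cast Nat.sub_lt hn one_pos

end AdjoinRoot

section MvPolynomial

variable {σ F : Type*} [Field F] [DecidableEq σ]

/-- If `v`, viewed as a polynomial in the variable `X i`, is monic of positive degree `n`, then
the polynomial ring has a Frobenius form over the subring where `X i` is replaced by `v`. -/
theorem exists_isFrobeniusForm_update (i : σ) (v : MvPolynomial σ F) (n : ℕ) (hn : 0 < n)
    (hm : (aeval (Function.update (fun j => Polynomial.C (X j)) i Polynomial.X) v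
      - Polynomial.C (X i) : Polynomial (MvPolynomial σ F)).Monic)
    (hd : (aeval (Function.update (fun j => Polynomial.C (X j)) i Polynomial.X) v
      - Polynomial.C (X i) : Polynomial (MvPolynomial σ F)).natDegree = n) :
    ∃ τ : MvPolynomial σ F →+ MvPolynomial σ F,
      IsFrobeniusForm (aeval (Function.update X i v) :
        MvPolynomial σ F →ₐ[F] MvPolynomial σ F).toRingHom τ ∧ τ (X i ^ (n - 1)) = 1 := by
  set G : Polynomial (MvPolynomial σ F) :=
    aeval (Function.update (fun j => Polynomial.C (X j)) i Polynomial.X) v with hG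
  set f := G - Polynomial.C (X i) with hf
  set φ : MvPolynomial σ F →ₐ[F] MvPolynomial σ F := aeval (Function.update X i v) with hφ
  obtain ⟨τ, h, h1⟩ := adjoinRoot_isFrobeniusForm hm (hd ▸ hn)
  let w : σ → AdjoinRoot f := Function.update (fun j => AdjoinRoot.of f (X j)) i (AdjoinRoot.root f)
  let b : MvPolynomial σ F →ₐ[F] AdjoinRoot f := aeval w
  have hGe : Polynomial.eval₂ φ.toRingHom (X i) G = v := by
    have : (Polynomial.eval₂RingHom φ.toRingHom (X i)).comp (aeval (Function.update
        (fun j => Polynomial.C (X j)) i Polynomial.X) :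
          _ →ₐ[F] Polynomial (MvPolynomial σ F)).toRingHom
        = RingHom.id _ := by
      apply MvPolynomial.ringHom_ext
      · intro r
        simp [MvPolynomial.algebraMap_eq, Polynomial.algebraMap_apply]
      · intro j
        by_cases hj : j = i
        · subst hj; simp
        · simp [hj, hφ]
    exact DFunLike.congr_fun this v
  let a : AdjoinRoot f →+* MvPolynomial σ F := AdjoinRoot.lift φ.toRingHom (X i) (by
    rw [hf, Polynomial.eval₂_sub, hGe]; simp [hφ])
  have hv : b v = AdjoinRoot.of f (X i) := by
    have h0 : AdjoinRoot.mk f G = AdjoinRoot.of f (X i) := by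
      rw [← AdjoinRoot.mk_C, ← sub_eq_zero, ← map_sub]
      exact AdjoinRoot.mk_self
    rw [← h0]
    have : b = ((AdjoinRoot.mkₐ f : Polynomial (MvPolynomial σ F) →ₐ[MvPolynomial σ F]
        _).restrictScalars F).comp (aeval
          (Function.update (fun j => Polynomial.C (X j)) i Polynomial.X)) := by
      apply MvPolynomial.algHom_ext
      intro j
      by_cases hj : j = i
      · subst hj; simp [b, w]
      · simp [b, w, hj]
    rw [this]
    rfl
  have hab : ∀ s, a (b s) = s := by
    intro s
    have : (a.comp b.toRingHom) = RingHom.id _ := by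
      apply MvPolynomial.ringHom_ext
      · intro r
        have : b (C r) = AdjoinRoot.of f (C r) := b.commutes r
        simp [this, a]
      · intro j
        by_cases hj : j = i
        · subst hj; simp [b, w, a]
        · simp [b, w, a, hj, hφ]
    exact DFunLike.congr_fun this s
  have hbφ : ∀ s, b (φ s) = AdjoinRoot.of f s := by
    intro s
    have : (b.toRingHom.comp φ.toRingHom) = AdjoinRoot.of f := by
      apply MvPolynomial.ringHom_ext
      · intro r
        exact (congrArg b (φ.commutes r)).trans (b.commutes r)
      · intro j
        by_cases hj : j = i
        · subst hj; simp [hφ, hv]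
        · simp [b, w, hj, hφ]
    exact DFunLike.congr_fun this s
  have hba : ∀ s, b (a s) = s := by
    intro s
    have : (b.toRingHom.comp a) = RingHom.id _ := by
      apply AdjoinRoot.ringHom_ext
      · ext s
        · simp only [a, RingHom.comp_apply, AdjoinRoot.lift_of, RingHom.id_apply]
          exact hbφ (C s)
        · simp [a, hbφ]
      · simp [a, b, w]
    exact DFunLike.congr_fun this s
  let e : AdjoinRoot f ≃+* MvPolynomial σ F := RingEquiv.ofRingHom a b.toRingHom
    (RingHom.ext hab) (RingHom.ext hba)
  have he : ((e : AdjoinRoot f →+* _).comp (AdjoinRoot.of f)) = φ.toRingHom := by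
    ext s
    · simp [e, a]
    · simp [e, a]
  refine ⟨_, he ▸ h.of_ringEquiv e, ?_⟩
  rw [hd] at h1
  rw [← h1]
  change τ (b (X i ^ (n - 1))) = _
  simp [b, w]

end MvPolynomial

section Dickson

variable (p : ℕ) [Fact p.Prime]

/-- The orbit product of `X 1` under the unipotent substitutions `X 1 ↦ X 1 + a X 0`. -/
def dicksonN : MvPolynomial (Fin 3) (ZMod p) := X 1 ^ p - X 0 ^ (p - 1) * X 1

/-- The Dickson invariant of degree `p (p - 1)`. -/
def dicksonQ : MvPolynomial (Fin 3) (ZMod p) := dicksonN p ^ (p - 1) + X 0 ^ (p * (p - 1))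

/-- The product of all lines, a relative invariant for `det`. -/
def dicksonL : MvPolynomial (Fin 3) (ZMod p) := X 0 * dicksonN p

/-- The action of `2 × 2` matrices on three variables, through the inverse determinant on the
last variable. -/
def blockAct {p : ℕ} [Fact p.Prime] (M : Matrix (Fin 2) (Fin 2) (ZMod p)) :
    MvPolynomial (Fin 3) (ZMod p) →ₐ[ZMod p] MvPolynomial (Fin 3) (ZMod p) :=
  aeval ![C (M 0 0) * X 0 + C (M 0 1) * X 1, C (M 1 0) * X 0 + C (M 1 1) * X 1, C (M.det)⁻¹ * X 2]

variable {p}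

theorem blockAct_mul (M N : Matrix (Fin 2) (Fin 2) (ZMod p)) (f) :
    blockAct (M * N) f = blockAct N (blockAct M f) := by
  have : blockAct (M * N) = (blockAct N).comp (blockAct M) := by
    apply MvPolynomial.algHom_ext
    intro i
    fin_cases i
    · simp [blockAct, Matrix.mul_apply, Fin.sum_univ_two]; ring
    · simp [blockAct, Matrix.mul_apply, Fin.sum_univ_two]; ring
    · simp [blockAct, mul_comm]; ring
  exact DFunLike.congr_fun this f

theorem blockAct_one (f) : blockAct (1 : Matrix (Fin 2) (Fin 2) (ZMod p)) f = f := by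
  have : blockAct (1 : Matrix (Fin 2) (Fin 2) (ZMod p)) = AlgHom.id _ _ := by
    apply MvPolynomial.algHom_ext
    intro i
    fin_cases i <;> simp [blockAct]
  exact DFunLike.congr_fun this f

theorem dicksonL_eq : dicksonL p = X 0 * X 1 ^ p - X 0 ^ p * X 1 := by
  have hp := (Fact.out : p.Prime).pos
  rw [dicksonL, dicksonN, mul_sub, ← mul_assoc, mul_pow_sub_one hp.ne']

theorem dicksonL_ne_zero : dicksonL p ≠ 0 := by
  intro h
  have := congrArg (aeval ![(1 : Polynomial (ZMod p)), Polynomial.X, 0]) h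
  simp only [dicksonL_eq, map_sub, _root_.map_mul, map_pow, aeval_X, map_zero] at this
  refine FiniteField.X_pow_card_sub_X_ne_zero (ZMod p) (Fact.out : p.Prime).one_lt ?_
  simpa using this

theorem dicksonQ_mul_dicksonL :
    dicksonQ p * dicksonL p = X 0 * (X 1 ^ p) ^ p - (X 0 ^ p) ^ p * X 1 := by
  have hp := (Fact.out : p.Prime).pos
  have h1 : dicksonN p ^ (p - 1) * dicksonN p = (X 1 ^ p) ^ p - (X 0 ^ (p - 1)) ^ p * X 1 ^ p := by
    rw [pow_sub_one_mul hp.ne', dicksonN, sub_pow_char, mul_pow]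
  have h2 : (X 0 ^ p : MvPolynomial (Fin 3) (ZMod p)) = X 0 ^ (p - 1) * X 0 :=
    (pow_sub_one_mul hp.ne' _).symm
  have h3 : (X 0 ^ (p - 1) : MvPolynomial (Fin 3) (ZMod p)) ^ p * X 0 ^ p = (X 0 ^ p) ^ p := by
    rw [← mul_pow, ← h2]
  calc dicksonQ p * dicksonL p = X 0 * (dicksonN p ^ (p - 1) * dicksonN p)
        + X 0 ^ (p * (p - 1)) * X 0 * dicksonN p := by rw [dicksonQ, dicksonL]; ring
    _ = _ := by
      rw [h1, mul_comm p, pow_mul, dicksonN, ← h3]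
      generalize (X 0 ^ (p - 1) : MvPolynomial (Fin 3) (ZMod p)) ^ p = y at *
      rw [h2]
      ring

/-- The power `dicksonL ^ (p - 1)`, up to sign, in terms of `dicksonQ` and the first variable. -/
theorem neg_dicksonL_pow :
    X 0 ^ (p * p - 1) - dicksonQ p * X 0 ^ (p - 1) = - dicksonL p ^ (p - 1) := by
  have hp := (Fact.out : p.Prime).pos
  have : p * p - 1 = p * (p - 1) + (p - 1) := by
    obtain ⟨k, rfl⟩ : ∃ k, p = k + 1 := ⟨p - 1, by omega⟩
    simp only [Nat.add_sub_cancel]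
    rw [Nat.sub_eq_iff_eq_add (by nlinarith)]
    ring
  rw [this, dicksonQ, dicksonL, pow_add, mul_pow]
  ring

theorem C_mul_X_add_pow_char (a b : ZMod p) (i j : Fin 3) :
    (C a * X i + C b * X j : MvPolynomial (Fin 3) (ZMod p)) ^ p =
      C a * X i ^ p + C b * X j ^ p := by
  rw [add_pow_char, mul_pow, mul_pow, ← C_pow, ← C_pow, ZMod.pow_card, ZMod.pow_card]

theorem C_mul_X_pow_add_pow_char (a b : ZMod p) (i j : Fin 3) :
    (C a * X i ^ p + C b * X j ^ p : MvPolynomial (Fin 3) (ZMod p)) ^ p =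
      C a * (X i ^ p) ^ p + C b * (X j ^ p) ^ p := by
  rw [add_pow_char, mul_pow, mul_pow, ← C_pow, ← C_pow, ZMod.pow_card, ZMod.pow_card]

theorem blockAct_dicksonL (M : Matrix (Fin 2) (Fin 2) (ZMod p)) :
    blockAct M (dicksonL p) = C M.det * dicksonL p := by
  rw [dicksonL_eq]
  simp only [blockAct, map_sub, _root_.map_mul, map_pow, aeval_X]
  simp only [Matrix.cons_val_zero, Matrix.cons_val_one, C_mul_X_add_pow_char, Matrix.det_fin_two,
    map_sub, _root_.map_mul]
  ring

theorem blockAct_dicksonQ {M : Matrix (Fin 2) (Fin 2) (ZMod p)} (hM : M.det ≠ 0) :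
    blockAct M (dicksonQ p) = dicksonQ p := by
  have h : blockAct M (dicksonQ p * dicksonL p) = C M.det * (dicksonQ p * dicksonL p) := by
    rw [dicksonQ_mul_dicksonL]
    simp only [blockAct, map_sub, _root_.map_mul, map_pow, aeval_X]
    simp only [Matrix.cons_val_zero, Matrix.cons_val_one, C_mul_X_add_pow_char,
      C_mul_X_pow_add_pow_char, Matrix.det_fin_two, map_sub, _root_.map_mul]
    ring
  rw [_root_.map_mul, blockAct_dicksonL] at h
  have h0 : C M.det * dicksonL p ≠ 0 := mul_ne_zero (by simpa using hM) dicksonL_ne_zero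
  exact mul_right_cancel₀ h0 (h.trans (by ring))

theorem blockAct_X_two (M : Matrix (Fin 2) (Fin 2) (ZMod p)) :
    blockAct M (X 2) = C (M.det)⁻¹ * X 2 := by
  simp [blockAct]

variable (p) in
/-- The inclusion of the parameter subring generated by `dicksonL ^ (p-1)`, `dicksonQ` and
`X 2 ^ (p - 1)`. -/
def dicksonParam : MvPolynomial (Fin 3) (ZMod p) →ₐ[ZMod p] MvPolynomial (Fin 3) (ZMod p) :=
  aeval ![- dicksonL p ^ (p - 1), dicksonQ p, X 2 ^ (p - 1)]

theorem blockAct_dicksonParam {M : Matrix (Fin 2) (Fin 2) (ZMod p)} (hM : M.det ≠ 0) (f) :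
    blockAct M (dicksonParam p f) = dicksonParam p f := by
  have : (blockAct M).comp (dicksonParam p) = dicksonParam p := by
    apply MvPolynomial.algHom_ext
    intro i
    fin_cases i
    · simp [dicksonParam, blockAct_dicksonL, mul_pow, ← C_pow, ZMod.pow_card_sub_one_eq_one hM]
    · simp [dicksonParam, blockAct_dicksonQ hM]
    · simp [dicksonParam, blockAct_X_two, mul_pow, ← C_pow,
        ZMod.pow_card_sub_one_eq_one hM, inv_pow]
  exact DFunLike.congr_fun this f

variable (p) in
/-- The monomial on which the Frobenius form over the parameter subring is `1`. -/
def dicksonTop : MvPolynomial (Fin 3) (ZMod p) :=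
  X 0 ^ (p * p - 1 - 1) * X 1 ^ (p * (p - 1) - 1) * X 2 ^ (p - 1 - 1)

theorem monic_natDegree_sub {R : Type*} [CommRing R] {P r : Polynomial R} (hP : P.Monic)
    (h : r.natDegree < P.natDegree) : (P - r).Monic ∧ (P - r).natDegree = P.natDegree :=
  ⟨hP.sub_of_left (Polynomial.degree_lt_degree h),
    Polynomial.natDegree_sub_eq_left_of_natDegree_lt h⟩

theorem exists_isFrobeniusForm_dicksonParam : ∃ τ : MvPolynomial (Fin 3) (ZMod p) →+ _,
    IsFrobeniusForm (dicksonParam p).toRingHom τ ∧ τ (dicksonTop p) = 1 := by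
  have hp := (Fact.out : p.Prime).one_lt
  have hpp : p - 1 < p * p - 1 := by
    have : p < p * p := by nlinarith
    omega
  have hpp' : 0 < p * (p - 1) := Nat.mul_pos (by omega) (by omega)
  obtain ⟨τ₁, h₁, h₁'⟩ := exists_isFrobeniusForm_update (F := ZMod p) (2 : Fin 3)
    (X 2 ^ (p - 1)) (p - 1)
    (by omega)
    (by simp only [map_pow, aeval_X, Function.update_self]
        exact Polynomial.monic_X_pow_sub_C _ (by omega))
    (by simp only [map_pow, aeval_X, Function.update_self]
        exact Polynomial.natDegree_X_pow_sub_C)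
  have key2 : ∀ a b : MvPolynomial (Fin 3) (ZMod p), (Polynomial.X ^ (p * p - 1)
      - Polynomial.C a * Polynomial.X ^ (p - 1) - Polynomial.C b).Monic ∧
      (Polynomial.X ^ (p * p - 1)
      - Polynomial.C a * Polynomial.X ^ (p - 1) - Polynomial.C b).natDegree = p * p - 1 := by
    intro a b
    have := monic_natDegree_sub (P := Polynomial.X ^ (p * p - 1))
      (r := Polynomial.C a * Polynomial.X ^ (p - 1) + Polynomial.C b) (Polynomial.monic_X_pow _) (by
        rw [Polynomial.natDegree_X_pow]
        refine lt_of_le_of_lt ?_ hpp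
        compute_degree)
    rwa [← sub_sub, Polynomial.natDegree_X_pow] at this
  have key3 : ∀ a b c : MvPolynomial (Fin 3) (ZMod p), ((Polynomial.X ^ p
      - Polynomial.C a * Polynomial.X) ^ (p - 1) + Polynomial.C b - Polynomial.C c).Monic ∧
      ((Polynomial.X ^ p - Polynomial.C a * Polynomial.X) ^ (p - 1)
        + Polynomial.C b - Polynomial.C c).natDegree =
        p * (p - 1) := by
    intro a b c
    have h1 := monic_natDegree_sub (P := Polynomial.X ^ p)
      (r := Polynomial.C a * Polynomial.X) (Polynomial.monic_X_pow _) (by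
        rw [Polynomial.natDegree_X_pow]
        refine lt_of_le_of_lt ?_ hp
        compute_degree)
    have hd : ((Polynomial.X ^ p - Polynomial.C a * Polynomial.X) ^ (p - 1)).natDegree =
        p * (p - 1) := by
      rw [h1.1.natDegree_pow, h1.2, Polynomial.natDegree_X_pow, mul_comm]
    have := monic_natDegree_sub (r := Polynomial.C (c - b)) (h1.1.pow (p - 1)) (by
      rw [hd, Polynomial.natDegree_C]; exact hpp')
    rw [hd, map_sub] at this
    have e : ∀ P : Polynomial (MvPolynomial (Fin 3) (ZMod p)), P + Polynomial.C b - Polynomial.C c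
        = P - (Polynomial.C c - Polynomial.C b) := fun P => by ring
    rwa [e]
  obtain ⟨τ₂, h₂, h₂'⟩ := exists_isFrobeniusForm_update (F := ZMod p) (0 : Fin 3)
    (X 0 ^ (p * p - 1) - X 1 * X 0 ^ (p - 1)) (p * p - 1) (by omega)
    (by simpa using (key2 (X 1) (X 0)).1) (by simpa using (key2 (X 1) (X 0)).2)
  obtain ⟨τ₃, h₃, h₃'⟩ := exists_isFrobeniusForm_update (F := ZMod p) (1 : Fin 3)
    (dicksonQ p) (p * (p - 1)) hpp'
    (by simpa [dicksonQ, dicksonN] using (key3 (X 0 ^ (p - 1)) (X 0 ^ (p * (p - 1))) (X 1)).1)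
    (by simpa [dicksonQ, dicksonN] using (key3 (X 0 ^ (p - 1)) (X 0 ^ (p * (p - 1))) (X 1)).2)
  have h := h₃.comp (h₂.comp h₁)
  set φ₁ : MvPolynomial (Fin 3) (ZMod p) →ₐ[ZMod p] MvPolynomial (Fin 3) (ZMod p) :=
    aeval (Function.update X 2 (X 2 ^ (p - 1)))
  set φ₂ : MvPolynomial (Fin 3) (ZMod p) →ₐ[ZMod p] MvPolynomial (Fin 3) (ZMod p) :=
    aeval (Function.update X 0 (X 0 ^ (p * p - 1) - X 1 * X 0 ^ (p - 1))) with hφ₂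
  set φ₃ : MvPolynomial (Fin 3) (ZMod p) →ₐ[ZMod p] MvPolynomial (Fin 3) (ZMod p) :=
    aeval (Function.update X 1 (dicksonQ p)) with hφ₃
  have hφ : φ₃.toRingHom.comp (φ₂.toRingHom.comp φ₁.toRingHom) = (dicksonParam p).toRingHom := by
    have : φ₃.comp (φ₂.comp φ₁) = dicksonParam p := by
      apply MvPolynomial.algHom_ext
      intro i
      fin_cases i
      · simp [φ₁, φ₂, φ₃, dicksonParam, neg_dicksonL_pow]
      · simp [φ₁, φ₂, φ₃, dicksonParam]
      · simp [φ₁, φ₂, φ₃, dicksonParam]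
    rw [← this]; rfl
  rw [hφ] at h
  refine ⟨_, h, ?_⟩
  have e3 : dicksonTop p =
      φ₃ (X 0 ^ (p * p - 1 - 1) * X 2 ^ (p - 1 - 1)) * X 1 ^ (p * (p - 1) - 1) := by
    simp [dicksonTop, φ₃]; ring
  have e2 : (X 0 ^ (p * p - 1 - 1) * X 2 ^ (p - 1 - 1) : MvPolynomial (Fin 3) (ZMod p))
      = φ₂ (X 2 ^ (p - 1 - 1)) * X 0 ^ (p * p - 1 - 1) := by
    simp [φ₂]; ring
  have m3 := h₃.map_mul (X 0 ^ (p * p - 1 - 1) * X 2 ^ (p - 1 - 1)) (X 1 ^ (p * (p - 1) - 1))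
  have m2 := h₂.map_mul (X 2 ^ (p - 1 - 1)) (X 0 ^ (p * p - 1 - 1))
  rw [h₃', mul_one] at m3
  rw [h₂', mul_one] at m2
  change τ₁ (τ₂ (τ₃ (dicksonTop p))) = 1
  rw [e3]
  erw [m3]
  rw [e2]
  erw [m2]
  exact h₁'

end Dickson

section Averaging

theorem IsFrobeniusForm.exists_apply_eq_C_mul {σ F : Type*} [Field F]
    {φ : MvPolynomial σ F →ₐ[F] MvPolynomial σ F} {τ : MvPolynomial σ F →+ MvPolynomial σ F}
    (h : IsFrobeniusForm φ.toRingHom τ) (γ γ' : MvPolynomial σ F →ₐ[F] MvPolynomial σ F)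
    (h1 : ∀ b, γ (γ' b) = b) (h1' : ∀ b, γ' (γ b) = b) (h2 : ∀ a, γ (φ a) = φ a) :
    ∃ c : F, ∀ s, τ (γ s) = C c * τ s := by
  obtain ⟨u, hu, hus⟩ := h.exists_isUnit γ.toRingHom γ'.toRingHom h1 h1' h2
    fun a => (congrArg γ' (h2 a).symm).trans (h1' _)
  obtain ⟨c, -, rfl⟩ := MvPolynomial.isUnit_iff_eq_C_of_isReduced.1 hu
  refine ⟨c, fun s => (hus s).trans ?_⟩
  rw [mul_comm, ← h.map_mul]
  exact congrArg (fun x => τ (x * s)) (φ.commutes c).symm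

theorem IsFrobeniusForm.apply_eq_of_apply_eq {σ F : Type*} [Field F]
    {φ : MvPolynomial σ F →ₐ[F] MvPolynomial σ F} {τ : MvPolynomial σ F →+ MvPolynomial σ F}
    (h : IsFrobeniusForm φ.toRingHom τ) (γ γ' : MvPolynomial σ F →ₐ[F] MvPolynomial σ F)
    (h1 : ∀ b, γ (γ' b) = b) (h1' : ∀ b, γ' (γ b) = b) (h2 : ∀ a, γ (φ a) = φ a)
    {m : MvPolynomial σ F} (hm : τ m = 1) (hγm : γ m = m) (s) : τ (γ s) = τ s := by
  obtain ⟨c, hc⟩ := h.exists_apply_eq_C_mul γ γ' h1 h1' h2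
  have := hc m
  rw [hγm, hm, mul_one] at this
  rw [hc, ← this, one_mul]

/-- A Frobenius form preserved by a finite group of invertible order induces one on the
invariants. -/
theorem IsFrobeniusForm.exists_average {A B R Γ : Type*} [CommRing A] [CommRing B] [CommRing R]
    [Group Γ] [Fintype Γ] {φ : A →+* B} {τ : B →+ A} (h : IsFrobeniusForm φ τ)
    (σ : Γ → B →+* B) (hσ : ∀ g k b, σ g (σ k b) = σ (k * g) b)
    (j : R →+* B) (hj : Function.Injective j) (hjR : ∀ b, (∃ r, j r = b) ↔ ∀ g, σ g b = b)
    (c : A) (hc : c * Fintype.card Γ = 1) (hφ : ∀ a g, σ g (φ a) = φ a)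
    (hτ : ∀ g b, τ (σ g b) = τ b) :
    ∃ (φ' : A →+* R) (τ' : R →+ A), IsFrobeniusForm φ' τ' := by
  have hfix : ∀ b g, σ g (φ c * ∑ k, σ k b) = φ c * ∑ k, σ k b := fun b g => by
    rw [_root_.map_mul, hφ, map_sum]
    simp only [hσ]
    exact congrArg (φ c * ·) (Equiv.sum_comp (Equiv.mulRight g) (fun k => σ k b))
  have hj' : ∀ r g, σ g (j r) = j r := fun r => (hjR _).1 ⟨r, rfl⟩
  choose ρ hρ using fun b => (hjR _).2 (hfix b)
  choose φ' hφ' using fun a => (hjR _).2 (hφ a)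
  let φ'' : A →+* R :=
    { toFun := φ'
      map_one' := hj (by simp [hφ'])
      map_zero' := hj (by simp [hφ'])
      map_mul' := fun a b => hj (by simp [hφ'])
      map_add' := fun a b => hj (by simp [hφ']) }
  refine ⟨φ'', _, h.retract j
    (AddMonoidHom.mk' ρ fun a b => hj (by simp [hρ, Finset.sum_add_distrib, mul_add]))
    (fun r b => hj ?_) (hj ?_) (fun b => ?_) hφ'⟩
  · simp only [AddMonoidHom.mk'_apply, hρ, _root_.map_mul, hj', ← Finset.mul_sum]
    ring
  · have := congrArg φ hc
    simpa [hρ] using this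
  · simp only [AddMonoidHom.mk'_apply, hρ]
    rw [h.map_mul, map_sum]
    simp only [hτ]
    rw [Finset.sum_const, Finset.card_univ, nsmul_eq_mul, ← mul_assoc, hc, one_mul]

end Averaging

section NonModular

variable {p : ℕ} [Fact p.Prime]

theorem blockAct_diagonal_dicksonTop (D : Fin 2 → ZMod p) (hD : (diagonal D).det ≠ 0) :
    blockAct (diagonal D) (dicksonTop p) = dicksonTop p := by
  have hp := (Fact.out : p.Prime).one_lt
  rw [det_diagonal, Fin.prod_univ_two] at hD
  have h0 := left_ne_zero_of_mul hD
  have h1 := right_ne_zero_of_mul hD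
  have key : ∀ (a : ZMod p) (k : ℕ), 0 < k → a ^ k = 1 → a * a ^ (k - 1) = 1 := fun a k hk h => by
    rw [mul_pow_sub_one hk.ne', h]
  have e : p * p - 1 = (p - 1) * (p + 1) := by
    obtain ⟨k, rfl⟩ : ∃ k, p = k + 1 := ⟨p - 1, by omega⟩
    simp only [Nat.add_sub_cancel]
    rw [Nat.sub_eq_iff_eq_add (by nlinarith)]
    ring
  have k0 := key (D 0) (p * p - 1) (by rw [e]; exact Nat.mul_pos (by omega) (by omega))
    (by rw [e, pow_mul, ZMod.pow_card_sub_one_eq_one h0, one_pow])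
  have k1 := key (D 1) (p * (p - 1)) (Nat.mul_pos (by omega) (by omega))
    (by rw [mul_comm, pow_mul, ZMod.pow_card_sub_one_eq_one h1, one_pow])
  have k2 := key (D 0 * D 1)⁻¹ (p - 1) (by omega) (ZMod.pow_card_sub_one_eq_one (inv_ne_zero hD))
  have k3 : D 0 ^ (p * p - 1 - 1) * D 1 ^ (p * (p - 1) - 1) * (D 0 * D 1)⁻¹ ^ (p - 1 - 1) = 1 := by
    have k2' : (D 0 * D 1)⁻¹ ^ (p - 1 - 1) = D 0 * D 1 := by
      rw [← inv_inv (D 0 * D 1)]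
      exact eq_inv_of_mul_eq_one_right (by rwa [inv_inv])
    rw [k2']
    calc _ = (D 0 * D 0 ^ (p * p - 1 - 1)) * (D 1 * D 1 ^ (p * (p - 1) - 1)) := by ring
      _ = 1 := by rw [k0, k1, one_mul]
  have k4 := congrArg (C : ZMod p → MvPolynomial (Fin 3) (ZMod p)) k3
  simp only [C_mul, C_1, C_pow] at k4
  calc blockAct (diagonal D) (dicksonTop p)
      = (C (D 0) ^ (p * p - 1 - 1) * C (D 1) ^ (p * (p - 1) - 1)
        * C ((D 0 * D 1)⁻¹) ^ (p - 1 - 1)) * dicksonTop p := by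
        simp only [blockAct, dicksonTop, _root_.map_mul, map_pow, aeval_X]
        simp [det_diagonal, mul_pow]
        ring
    _ = _ := by rw [k4, one_mul]

theorem transvection_pow_card (t : TransvectionStruct (Fin 2) (ZMod p)) : t.toMatrix ^ p = 1 := by
  obtain ⟨i, j, hij, c⟩ := t
  have : ∀ n : ℕ, (transvection i j c) ^ n = transvection i j (n * c) := by
    intro n
    induction n with
    | zero => simp
    | succ n ih =>
      rw [pow_succ, ih, transvection_mul_transvection_same _ _ hij]
      push_cast
      ring_nf
  simp [TransvectionStruct.toMatrix, this]

theorem apply_blockAct {τ : MvPolynomial (Fin 3) (ZMod p) →+ MvPolynomial (Fin 3) (ZMod p)}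
    (h : IsFrobeniusForm (dicksonParam p).toRingHom τ) (h1 : τ (dicksonTop p) = 1)
    (M : Matrix (Fin 2) (Fin 2) (ZMod p)) (hM : M.det ≠ 0) (s) :
    τ (blockAct M s) = τ s := by
  have hinv : ∀ M : Matrix (Fin 2) (Fin 2) (ZMod p), M.det ≠ 0 →
      (∀ b, blockAct M (blockAct M⁻¹ b) = b) ∧ ∀ b, blockAct M⁻¹ (blockAct M b) = b := by
    intro M hM
    have hu : IsUnit M.det := hM.isUnit
    exact ⟨fun b => by rw [← blockAct_mul, nonsing_inv_mul _ hu, blockAct_one],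
      fun b => by rw [← blockAct_mul, mul_nonsing_inv _ hu, blockAct_one]⟩
  refine diagonal_transvection_induction_of_det_ne_zero (fun M => ∀ s, τ (blockAct M s) = τ s) M hM
    ?_ ?_ ?_ s
  · intro D hD s
    exact h.apply_eq_of_apply_eq _ _ (hinv _ hD).1 (hinv _ hD).2 (blockAct_dicksonParam hD) h1
      (blockAct_diagonal_dicksonTop D hD) s
  · intro t s
    have ht : t.toMatrix.det ≠ 0 := by rw [TransvectionStruct.det]; exact one_ne_zero
    obtain ⟨c, hc⟩ := h.exists_apply_eq_C_mul _ _ (hinv _ ht).1 (hinv _ ht).2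
      (blockAct_dicksonParam ht)
    have hn : ∀ n : ℕ, ∀ s, τ (blockAct (t.toMatrix ^ n) s) = C (c ^ n) * τ s := by
      intro n
      induction n with
      | zero => intro s; simp [blockAct_one]
      | succ n ih => intro s; rw [pow_succ, blockAct_mul, hc, ih, pow_succ, C_mul]; ring
    have := hn p (dicksonTop p)
    rw [transvection_pow_card, blockAct_one, h1, ZMod.pow_card, mul_one, eq_comm] at this
    rw [hc, this, one_mul]
  · intro A B hA hB ihA ihB s
    rw [blockAct_mul, ihB, ihA]

/-- The invariants of a linear group of degree two acting on three variables. -/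
def blockInv (H : Subgroup (GL (Fin 2) (ZMod p))) :
    Subalgebra (ZMod p) (MvPolynomial (Fin 3) (ZMod p)) where
  carrier := {f | ∀ h ∈ H, blockAct (h : Matrix (Fin 2) (Fin 2) (ZMod p)) f = f}
  mul_mem' := fun hf hg => fun M hM => by rw [_root_.map_mul, hf M hM, hg M hM]
  add_mem' := fun hf hg => fun M hM => by rw [_root_.map_add, hf M hM, hg M hM]
  algebraMap_mem' := fun r => fun M _ => (blockAct (M : Matrix (Fin 2) (Fin 2) (ZMod p))).commutes r

theorem det_coe_ne_zero (h : GL (Fin 2) (ZMod p)) :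
    (h : Matrix (Fin 2) (Fin 2) (ZMod p)).det ≠ 0 := by
  rw [← GeneralLinearGroup.val_det_apply]
  exact Units.ne_zero _

theorem exists_C_mul_card (n : ℕ) (hn : ¬ p ∣ n) :
    ∃ c : MvPolynomial (Fin 3) (ZMod p), c * n = 1 := by
  have h : (n : ZMod p) ≠ 0 := by rwa [Ne, ZMod.natCast_eq_zero_iff]
  refine ⟨C (n : ZMod p)⁻¹, ?_⟩
  rw [← map_natCast (C : ZMod p →+* MvPolynomial (Fin 3) (ZMod p)), ← C_mul, inv_mul_cancel₀ h, C_1]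

theorem exists_isFrobeniusForm_of_not_dvd (H : Subgroup (GL (Fin 2) (ZMod p)))
    (hH : ¬ p ∣ Nat.card H) :
    ∃ (φ : MvPolynomial (Fin 3) (ZMod p) →+* blockInv H) (τ : blockInv H →+ _),
      IsFrobeniusForm φ τ := by
  obtain ⟨τ, h, h1⟩ := exists_isFrobeniusForm_dicksonParam (p := p)
  have : Finite (GL (Fin 2) (ZMod p)) := inferInstance
  have := Fintype.ofFinite H
  obtain ⟨c, hc⟩ := exists_C_mul_card _ hH
  rw [Nat.card_eq_fintype_card] at hc
  refine h.exists_average (Γ := H)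
    (fun g => (blockAct ((g : GL (Fin 2) (ZMod p)) : Matrix (Fin 2) (Fin 2) (ZMod p))).toRingHom)
    (fun g k b => (blockAct_mul _ _ b).symm) (blockInv H).subtype Subtype.val_injective ?_ c hc
    (fun a g => blockAct_dicksonParam (det_coe_ne_zero _) a)
    (fun g b => apply_blockAct h h1 _ (det_coe_ne_zero _) b)
  exact fun b => ⟨fun ⟨r, hr⟩ g => hr ▸ r.2 g g.2, fun hb => ⟨⟨b, fun g hg => hb ⟨g, hg⟩⟩, rfl⟩⟩

end NonModular

section Substitution

variable {σ F : Type*} [Field F] [DecidableEq σ]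

/-- Replace the variable `X i` by `v`. -/
def replaceVar (i : σ) (v : MvPolynomial σ F) : MvPolynomial σ F →ₐ[F] MvPolynomial σ F :=
  aeval (Function.update X i v)

@[simp] theorem replaceVar_X_self (i : σ) (v : MvPolynomial σ F) : replaceVar i v (X i) = v := by
  simp [replaceVar]

theorem replaceVar_X_of_ne {i j : σ} (h : j ≠ i) (v : MvPolynomial σ F) :
    replaceVar i v (X j) = X j := by
  simp [replaceVar, h]

theorem replaceVar_comp (i : σ) (v w : MvPolynomial σ F) (f) :
    replaceVar i v (replaceVar i w f) = replaceVar i (replaceVar i v w) f := by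
  have : (replaceVar i v).comp (replaceVar i w) = replaceVar i (replaceVar i v w) := by
    apply MvPolynomial.algHom_ext
    intro j
    by_cases h : j = i
    · subst h; simp
    · simp [replaceVar_X_of_ne h]
  exact DFunLike.congr_fun this f

theorem replaceVar_of_replaceVar_zero {i : σ} {w : MvPolynomial σ F} (hw : replaceVar i 0 w = w)
    (v) : replaceVar i v w = w := by
  rw [← hw, replaceVar_comp, _root_.map_zero]

theorem X_sub_dvd_sub_replaceVar (i : σ) (w f : MvPolynomial σ F) :
    X i - w ∣ f - replaceVar i w f := by
  rw [← Ideal.mem_span_singleton, ← Ideal.Quotient.eq]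
  have : Ideal.Quotient.mkₐ F (Ideal.span {X i - w})
      = (Ideal.Quotient.mkₐ F (Ideal.span {X i - w})).comp (replaceVar i w) := by
    apply MvPolynomial.algHom_ext
    intro j
    by_cases h : j = i
    · subst h
      simp only [AlgHom.comp_apply, replaceVar_X_self]
      exact Ideal.Quotient.eq.2 (Ideal.mem_span_singleton_self _)
    · simp [replaceVar_X_of_ne h]
  exact DFunLike.congr_fun this f

theorem prod_X_sub_dvd {i : σ} (Λ : Finset (MvPolynomial σ F))
    (hΛ : ∀ w ∈ Λ, replaceVar i 0 w = w) (f : MvPolynomial σ F)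
    (hf : ∀ w ∈ Λ, replaceVar i w f = 0) : ∏ w ∈ Λ, (X i - w) ∣ f := by
  classical
  induction Λ using Finset.induction_on generalizing f with
  | empty => simp
  | insert w Λ hw ih =>
    have h := X_sub_dvd_sub_replaceVar i w f
    rw [hf w (Finset.mem_insert_self _ _), sub_zero] at h
    obtain ⟨g, rfl⟩ := h
    rw [Finset.prod_insert hw]
    refine mul_dvd_mul_left _ (ih (fun v hv => hΛ v (Finset.mem_insert_of_mem hv)) g fun v hv => ?_)
    have := hf v (Finset.mem_insert_of_mem hv)
    rw [_root_.map_mul, map_sub, replaceVar_X_self,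
      replaceVar_of_replaceVar_zero (hΛ w (Finset.mem_insert_self _ _))] at this
    refine (mul_eq_zero.1 this).resolve_left fun h => hw ?_
    rwa [← sub_eq_zero.1 h]

theorem degreeOf_replaceVar_zero (i : σ) (f : MvPolynomial σ F) :
    degreeOf i (replaceVar i 0 f) = 0 := by
  rw [← Nat.le_zero]
  induction f using MvPolynomial.induction_on with
  | C a => simp [replaceVar]
  | add f g hf hg =>
    rw [_root_.map_add]
    exact (degreeOf_add_le _ _ _).trans (max_le hf hg)
  | mul_X f j hf =>
    rw [_root_.map_mul]
    by_cases h : j = i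
    · subst h; simp
    · rw [replaceVar_X_of_ne h]
      exact (degreeOf_mul_le _ _ _).trans (by simpa [degreeOf_X, Ne.symm h] using hf)

theorem replaceVar_prod_X_sub {i : σ} (Λ : Finset (MvPolynomial σ F))
    (hadd : ∀ u ∈ Λ, ∀ w ∈ Λ, w + u ∈ Λ) (hΛ : ∀ w ∈ Λ, replaceVar i 0 w = w)
    {u : MvPolynomial σ F} (hu : u ∈ Λ) :
    replaceVar i (X i + u) (∏ w ∈ Λ, (X i - w)) = ∏ w ∈ Λ, (X i - w) := by
  classical
  have him : Λ.image (· + u) = Λ := by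
    refine Finset.eq_of_subset_of_card_le (fun w hw => ?_) ?_
    · obtain ⟨v, hv, rfl⟩ := Finset.mem_image.1 hw
      exact hadd u hu v hv
    · rw [Finset.card_image_of_injective _ (add_left_injective u)]
  calc _ = ∏ w ∈ Λ, (X i + u - w) := by
        rw [map_prod]
        refine Finset.prod_congr rfl fun w hw => ?_
        rw [map_sub, replaceVar_X_self, replaceVar_of_replaceVar_zero (hΛ w hw)]
    _ = ∏ w ∈ Λ.image (· + u), (X i + u - w) := by rw [him]
    _ = _ := by
        rw [Finset.prod_image fun a _ b _ h => add_left_injective u h]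
        exact Finset.prod_congr rfl fun w _ => by ring

/-- Polynomials invariant under a finite group of translations of the variable `X i` are
polynomials in the orbit product of `X i`. -/
theorem exists_replaceVar_eq {i : σ} (Λ : Finset (MvPolynomial σ F)) (h0 : 0 ∈ Λ)
    (hadd : ∀ u ∈ Λ, ∀ w ∈ Λ, w + u ∈ Λ) (hΛ : ∀ w ∈ Λ, replaceVar i 0 w = w)
    (f : MvPolynomial σ F) (hf : ∀ w ∈ Λ, replaceVar i (X i + w) f = f) :
    ∃ g, replaceVar i (∏ w ∈ Λ, (X i - w)) g = f := by
  classical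
  set P := ∏ w ∈ Λ, (X i - w) with hP
  have hne : ∀ w ∈ Λ, (X i : MvPolynomial σ F) - w ≠ 0 := fun w hw h => by
    have := congrArg (replaceVar i (w + 1)) h
    rw [map_sub, replaceVar_X_self, replaceVar_of_replaceVar_zero (hΛ w hw)] at this
    simp at this
  have hP0 : P ≠ 0 := Finset.prod_ne_zero_iff.2 hne
  have hPdeg : 0 < degreeOf i P := by
    have : X i ∣ P := by
      have := Finset.dvd_prod_of_mem (fun w => (X i : MvPolynomial σ F) - w) h0
      simpa using this
    obtain ⟨r, hr⟩ := this
    rw [hr, degreeOf_mul_eq (X_ne_zero i) (right_ne_zero_of_mul (hr ▸ hP0)), degreeOf_X]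
    simp
  have hPinv : ∀ u ∈ Λ, replaceVar i (X i + u) P = P := fun u hu =>
    replaceVar_prod_X_sub Λ hadd hΛ hu
  induction hn : degreeOf i f using Nat.strong_induction_on generalizing f with
  | _ n ih =>
    set f₀ := replaceVar i 0 f with hf₀
    have hf₀' : ∀ v, replaceVar i v f₀ = f₀ := fun v => by
      rw [hf₀, replaceVar_comp, _root_.map_zero]
    obtain ⟨q, hq⟩ : P ∣ f - f₀ := prod_X_sub_dvd Λ hΛ _ fun w hw => by
      rw [map_sub, hf₀', hf₀]
      nth_rewrite 2 [← hf w hw]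
      rw [replaceVar_comp, _root_.map_add, hΛ w hw, replaceVar_X_self, zero_add, sub_self]
    by_cases hq0 : q = 0
    · exact ⟨f₀, by rw [hf₀', ← sub_eq_zero, ← neg_sub, hq, hq0, mul_zero, neg_zero]⟩
    have hqi : ∀ w ∈ Λ, replaceVar i (X i + w) q = q := fun w hw => by
      have := congrArg (replaceVar i (X i + w)) hq
      rw [map_sub, hf w hw, hf₀', _root_.map_mul, hPinv w hw, hq] at this
      exact (mul_left_cancel₀ hP0 this).symm
    have hdeg : degreeOf i q < n := by
      have h1 := degreeOf_sub_le i f f₀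
      rw [hq, degreeOf_mul_eq hP0 hq0, hf₀, degreeOf_replaceVar_zero, hn] at h1
      omega
    obtain ⟨g, hg⟩ := ih _ hdeg q hqi rfl
    exact ⟨f₀ + X i * g, by
      rw [_root_.map_add, _root_.map_mul, hg, hf₀', replaceVar_X_self, ← hq]; ring⟩

end Substitution

section Coefficients

variable {σ F : Type*} [Field F] [DecidableEq σ]

theorem coeff_replaceVar_zero (i : σ) (f : MvPolynomial σ F) (d : σ →₀ ℕ) :
    coeff d (replaceVar i 0 f) = if d i = 0 then coeff d f else 0 := by
  induction f using MvPolynomial.induction_on generalizing d with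
  | C a =>
    rw [algHom_C, algebraMap_eq, coeff_C]
    by_cases h : 0 = d
    · simp [← h]
    · simp [h]
  | add f g hf hg =>
    rw [_root_.map_add, coeff_add, hf, hg, coeff_add]
    split_ifs <;> simp
  | mul_X f j hf =>
    rw [_root_.map_mul]
    by_cases h : j = i
    · subst h
      rw [replaceVar_X_self, mul_zero, coeff_zero, coeff_mul_X']
      by_cases hd : d j = 0 <;> simp [hd]
    · rw [replaceVar_X_of_ne h, coeff_mul_X', coeff_mul_X', hf]
      have : (d - Finsupp.single j 1 : σ →₀ ℕ) i = d i := by simp [h]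
      rw [this]
      split_ifs <;> rfl

theorem dvd_of_coeff_replaceVar_pow_ne_zero (i : σ) (n : ℕ) (f : MvPolynomial σ F) (d : σ →₀ ℕ)
    (hd : coeff d (replaceVar i (X i ^ n) f) ≠ 0) : n ∣ d i := by
  induction f using MvPolynomial.induction_on generalizing d with
  | C a =>
    rw [algHom_C, algebraMap_eq, coeff_C] at hd
    by_cases h : 0 = d
    · simp [← h]
    · simp [h] at hd
  | add f g hf hg =>
    rw [_root_.map_add, coeff_add] at hd
    by_contra h
    exact hd (by rw [not_not.1 (mt (hf d) h), not_not.1 (mt (hg d) h), add_zero])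
  | mul_X f j hf =>
    rw [_root_.map_mul] at hd
    by_cases h : j = i
    · subst h
      rw [replaceVar_X_self] at hd
      nth_rewrite 2 [X_pow_eq_monomial] at hd
      rw [coeff_mul_monomial', mul_one] at hd
      split_ifs at hd with hle
      · have := hf _ hd
        have h2 : n ≤ d j := by simpa using hle j
        rw [Finsupp.tsub_apply, Finsupp.single_eq_same] at this
        simpa [Nat.sub_add_cancel h2] using dvd_add this (dvd_refl n)
      · exact absurd rfl hd
    · rw [replaceVar_X_of_ne h, coeff_mul_X'] at hd
      split_ifs at hd
      · simpa [h] using hf _ hd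
      · exact absurd rfl hd

theorem coeff_aeval_C_mul_X [Fintype σ] (c : σ → F) (f : MvPolynomial σ F) (d : σ →₀ ℕ) :
    coeff d (aeval (fun i => C (c i) * X i) f : MvPolynomial σ F)
      = (∏ i, c i ^ d i) * coeff d f := by
  induction f using MvPolynomial.induction_on generalizing d with
  | C a =>
    rw [algHom_C, algebraMap_eq, coeff_C]
    by_cases h : 0 = d
    · simp [← h]
    · simp [h]
  | add f g hf hg => rw [_root_.map_add, coeff_add, hf, hg, coeff_add, mul_add]
  | mul_X f j hf =>
    rw [_root_.map_mul, aeval_X, mul_left_comm, coeff_C_mul, coeff_mul_X', coeff_mul_X', hf]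
    split_ifs with h
    · rw [← mul_assoc]
      congr 1
      have hj : d j ≠ 0 := by simpa using h
      rw [← Finset.mul_prod_erase _ _ (Finset.mem_univ j), ← mul_assoc,
        ← Finset.mul_prod_erase _ _ (Finset.mem_univ j)]
      congr 1
      · rw [← pow_succ']
        congr 1
        simp only [Finsupp.tsub_apply, Finsupp.single_eq_same]
        omega
      · refine Finset.prod_congr rfl fun i hi => ?_
        simp [(Finset.ne_of_mem_erase hi)]
    · simp

end Coefficients

section DicksonInvariants

variable {p : ℕ} [Fact p.Prime]

theorem prod_X_sub_C_mul_X : ∏ a : ZMod p, (X 1 - C a * X 0) = dicksonN p := by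
  have hp := (Fact.out : p.Prime).one_lt
  have h1 : ∏ a : ZMod p, (Polynomial.X - Polynomial.C a) = Polynomial.X ^ p - Polynomial.X := by
    have h2 := FiniteField.roots_X_pow_card_sub_X (ZMod p)
    rw [ZMod.card] at h2
    have h3 := monic_natDegree_sub (P := Polynomial.X ^ p)
      (r := (Polynomial.X : Polynomial (ZMod p))) (Polynomial.monic_X_pow _) (by simpa using hp)
    rw [← Polynomial.prod_multiset_X_sub_C_of_monic_of_roots_card_eq h3.1 (by
      rw [h2, h3.2, Polynomial.natDegree_X_pow]; simp [ZMod.card]), h2]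
    rfl
  let K := FractionRing (MvPolynomial (Fin 3) (ZMod p))
  let ι := algebraMap (MvPolynomial (Fin 3) (ZMod p)) K
  have hι : Function.Injective ι := IsFractionRing.injective _ _
  have hx : ι (X 0) ≠ 0 := by rw [Ne, map_eq_zero_iff _ hι]; exact X_ne_zero _
  have h4 := congrArg (Polynomial.eval₂ (ι.comp C) (ι (X 1) / ι (X 0))) h1
  rw [Polynomial.eval₂_finsetProd] at h4
  simp only [Polynomial.eval₂_sub, Polynomial.eval₂_X, Polynomial.eval₂_C, Polynomial.eval₂_pow,
    RingHom.comp_apply] at h4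
  apply hι
  rw [map_prod]
  calc _ = ∏ a : ZMod p, (ι (X 0) * (ι (X 1) / ι (X 0) - ι (C a))) := by
        refine Finset.prod_congr rfl fun a _ => ?_
        rw [map_sub, _root_.map_mul, mul_sub, mul_div_cancel₀ _ hx, mul_comm (ι (C a))]
    _ = ι (X 0) ^ p * ((ι (X 1) / ι (X 0)) ^ p - ι (X 1) / ι (X 0)) := by
        rw [Finset.prod_mul_distrib, h4, Finset.prod_const, Finset.card_univ, ZMod.card]
    _ = _ := by
        have : ι (X 0) ^ p = ι (X 0) ^ (p - 1) * ι (X 0) := by rw [pow_sub_one_mul (by omega)]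
        rw [dicksonN, map_sub, map_pow, _root_.map_mul, map_pow, mul_sub, div_pow,
          mul_div_cancel₀ _ (pow_ne_zero _ hx)]
        rw [this, mul_assoc, mul_div_cancel₀ _ hx]

/-- The inclusion of the ring of Dickson invariants, with an extra variable. -/
def dicksonInv (p : ℕ) [Fact p.Prime] :
    MvPolynomial (Fin 3) (ZMod p) →ₐ[ZMod p] MvPolynomial (Fin 3) (ZMod p) :=
  aeval ![dicksonL p, dicksonQ p, X 2]

theorem blockAct_dicksonInv_of_det {M : Matrix (Fin 2) (Fin 2) (ZMod p)} (hM : M.det ≠ 0) (f) :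
    blockAct M (dicksonInv p f)
      = dicksonInv p (aeval ![C M.det * X 0, X 1, C (M.det)⁻¹ * X 2] f) := by
  have : (blockAct M).comp (dicksonInv p)
      = (dicksonInv p).comp (aeval ![C M.det * X 0, X 1, C (M.det)⁻¹ * X 2]) := by
    apply MvPolynomial.algHom_ext
    intro i
    fin_cases i
    · simp [dicksonInv, blockAct_dicksonL]
    · simp [dicksonInv, blockAct_dicksonQ hM]
    · simp [dicksonInv, blockAct_X_two]
  exact DFunLike.congr_fun this f

theorem blockAct_dicksonInv {M : Matrix (Fin 2) (Fin 2) (ZMod p)} (hM : M.det = 1) (f) :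
    blockAct M (dicksonInv p f) = dicksonInv p f := by
  rw [blockAct_dicksonInv_of_det (by rw [hM]; exact one_ne_zero), hM]
  congr 1
  have : (![C 1 * X 0, X 1, C (1 : ZMod p)⁻¹ * X 2] : Fin 3 → MvPolynomial (Fin 3) (ZMod p)) =
      X := by
    ext1 i; fin_cases i <;> simp
  rw [this, aeval_X_left_apply]

theorem dvd_of_coeff_ne_zero_of_invariant {f : MvPolynomial (Fin 3) (ZMod p)}
    (hf : ∀ M : Matrix (Fin 2) (Fin 2) (ZMod p), M.det = 1 → blockAct M f = f)
    {d : Fin 3 →₀ ℕ} (hd : coeff d f ≠ 0) (hd0 : d 0 = 0) : p * (p - 1) ∣ d 1 := by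
  have hp := (Fact.out : p.Prime).one_lt
  refine Nat.Coprime.mul_dvd_of_dvd_of_dvd ?_ ?_ ?_
  · exact (Nat.coprime_self_sub_right hp.le).2 (Nat.coprime_one_right _)
  · obtain ⟨g, rfl⟩ := exists_replaceVar_eq (i := (1 : Fin 3))
      (Finset.univ.image fun a : ZMod p => (C a * X 0 : MvPolynomial (Fin 3) (ZMod p)))
      (Finset.mem_image.2 ⟨0, by simp⟩)
      (fun u hu w hw => by
        obtain ⟨a, -, rfl⟩ := Finset.mem_image.1 hu
        obtain ⟨b, -, rfl⟩ := Finset.mem_image.1 hw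
        exact Finset.mem_image.2 ⟨b + a, by simp [add_mul]⟩)
      (fun w hw => by
        obtain ⟨a, -, rfl⟩ := Finset.mem_image.1 hw
        simp [replaceVar]) f (fun w hw => by
        obtain ⟨a, -, rfl⟩ := Finset.mem_image.1 hw
        refine Eq.trans ?_ (hf !![1, 0; a, 1] (by simp [det_fin_two]))
        congr 1
        apply MvPolynomial.algHom_ext
        intro i
        fin_cases i <;> simp [replaceVar, blockAct, add_comm, det_fin_two])
    have hinj : Function.Injective fun a : ZMod p => (C a * X 0 : MvPolynomial (Fin 3) (ZMod p)) :=
      fun a b h => C_injective _ _ (mul_right_cancel₀ (X_ne_zero _) h)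
    rw [Finset.prod_image fun a _ b _ h => hinj h, prod_X_sub_C_mul_X] at hd
    have e : (replaceVar 0 0).comp (replaceVar 1 (dicksonN p))
        = (replaceVar 1 (X 1 ^ p)).comp
            (replaceVar (0 : Fin 3) (0 : MvPolynomial (Fin 3) (ZMod p))) := by
      apply MvPolynomial.algHom_ext
      intro i
      fin_cases i <;> simp [replaceVar, dicksonN, show p - 1 ≠ 0 by omega]
    have := DFunLike.congr_fun e g
    simp only [AlgHom.comp_apply] at this
    refine dvd_of_coeff_replaceVar_pow_ne_zero 1 p (replaceVar 0 0 g) _ ?_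
    rwa [← this, coeff_replaceVar_zero, if_pos hd0]
  · obtain ⟨a, ha⟩ := IsCyclic.exists_generator (α := (ZMod p)ˣ)
    have horder : orderOf a = p - 1 := by
      rw [orderOf_eq_card_of_forall_mem_zpowers ha, Nat.card_eq_fintype_card, ZMod.card_units]
    have hba : ((a⁻¹ : (ZMod p)ˣ) : ZMod p) * a = 1 := by rw [← Units.val_mul]; simp
    rw [← horder, ← orderOf_units]
    apply orderOf_dvd_of_pow_eq_one
    generalize ((a⁻¹ : (ZMod p)ˣ) : ZMod p) = b, (a : ZMod p) = c at hba
    have hdet : (diagonal ![b, c]).det = 1 := by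
      simp [det_diagonal, Fin.prod_univ_two, hba]
    have h := hf _ hdet
    have e : (blockAct (diagonal ![b, c]))
        = aeval fun i => C ((![b, c, 1] : Fin 3 → ZMod p) i) * X i := by
      apply MvPolynomial.algHom_ext
      intro i
      fin_cases i
      · simp [blockAct]
      · simp [blockAct]
      · simp only [blockAct, hdet]; simp
    rw [e] at h
    have h2 := congrArg (coeff d) h
    rw [coeff_aeval_C_mul_X] at h2
    have h3 := mul_right_cancel₀ hd (h2.trans (one_mul _).symm)
    simpa [Fin.prod_univ_three, hd0] using h3

theorem dicksonL_dvd_of_invariant {f : MvPolynomial (Fin 3) (ZMod p)}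
    (hf : ∀ M : Matrix (Fin 2) (Fin 2) (ZMod p), M.det = 1 → blockAct M f = f)
    (hf0 : replaceVar 0 0 f = 0) : dicksonL p ∣ f := by
  have hp := (Fact.out : p.Prime).one_lt
  have h := prod_X_sub_dvd (i := (1 : Fin 3))
      (Finset.univ.image fun a : ZMod p => (C a * X 0 : MvPolynomial (Fin 3) (ZMod p)))
      (fun w hw => by
        obtain ⟨a, -, rfl⟩ := Finset.mem_image.1 hw
        simp [replaceVar]) f (fun w hw => by
        obtain ⟨a, -, rfl⟩ := Finset.mem_image.1 hw
        have e : (replaceVar 1 (C a * X 0)).comp (blockAct !![a, -1; 1, 0])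
          = (replaceVar 1 (X 0)).comp
              (replaceVar (0 : Fin 3) (0 : MvPolynomial (Fin 3) (ZMod p))) := by
          apply MvPolynomial.algHom_ext
          intro i
          fin_cases i <;> simp [replaceVar, blockAct, det_fin_two]
        have := DFunLike.congr_fun e f
        rwa [AlgHom.comp_apply, AlgHom.comp_apply, hf0, hf _ (by simp [det_fin_two]),
          _root_.map_zero] at this)
  have hinj : Function.Injective fun a : ZMod p => (C a * X 0 : MvPolynomial (Fin 3) (ZMod p)) :=
    fun a b h => C_injective _ _ (mul_right_cancel₀ (X_ne_zero _) h)
  rw [Finset.prod_image fun a _ b _ h => hinj h, prod_X_sub_C_mul_X] at h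
  obtain ⟨q, rfl⟩ := h
  have hN : replaceVar 0 0 (dicksonN p) ≠ 0 := by
    simp [replaceVar, dicksonN, show p - 1 ≠ 0 by omega]
  rw [_root_.map_mul, mul_eq_zero] at hf0
  have hq := X_sub_dvd_sub_replaceVar 0 0 q
  rw [hf0.resolve_left hN, sub_zero, sub_zero] at hq
  rw [dicksonL, mul_comm]
  exact mul_dvd_mul_left _ hq

theorem totalDegree_dicksonQ_le : (dicksonQ p).totalDegree ≤ p * (p - 1) := by
  have hp := (Fact.out : p.Prime).one_lt
  have hN : (dicksonN p).totalDegree ≤ p := by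
    refine (totalDegree_sub _ _).trans (max_le ?_ ?_)
    · rw [totalDegree_X_pow]
    · refine (totalDegree_mul _ _).trans ?_
      rw [totalDegree_X_pow, totalDegree_X]
      omega
  refine (totalDegree_add _ _).trans (max_le ?_ ?_)
  · refine (totalDegree_pow _ _).trans ?_
    rw [mul_comm p]
    exact Nat.mul_le_mul_left _ hN
  · rw [totalDegree_X_pow]

/-- Dickson's theorem for `SL₂(𝔽_p)`. -/
theorem exists_dicksonInv_eq (f : MvPolynomial (Fin 3) (ZMod p))
    (hf : ∀ M : Matrix (Fin 2) (Fin 2) (ZMod p), M.det = 1 → blockAct M f = f) :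
    ∃ g, dicksonInv p g = f := by
  have hp := (Fact.out : p.Prime).one_lt
  induction hn : totalDegree f using Nat.strong_induction_on generalizing f with
  | _ n ih =>
    set k : MvPolynomial (Fin 3) (ZMod p) := ∑ d ∈ f.support.filter (· 0 = 0),
      C (coeff d f) * X 1 ^ (d 1 / (p * (p - 1))) * X 2 ^ d 2 with hk
    have hkdeg : (dicksonInv p k).totalDegree ≤ n := by
      rw [hk, map_sum]
      refine totalDegree_finsetSum_le fun d hd => ?_
      rw [Finset.mem_filter] at hd
      have h1 := le_totalDegree hd.1
      have h2 := Nat.div_mul_cancel (dvd_of_coeff_ne_zero_of_invariant hf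
        (mem_support_iff.1 hd.1) hd.2)
      rw [hn, Finsupp.sum_fintype _ _ (fun _ => rfl), Fin.sum_univ_three] at h1
      simp only [dicksonInv, _root_.map_mul, map_pow, aeval_X, algHom_C, algebraMap_eq]
      simp only [Matrix.cons_val]
      refine (totalDegree_mul _ _).trans ?_
      refine (add_le_add ((totalDegree_mul _ _).trans (add_le_add_right (totalDegree_pow _ _) _))
        le_rfl).trans ?_
      rw [totalDegree_C, totalDegree_X_pow]
      have h3 := Nat.mul_le_mul_left (d 1 / (p * (p - 1))) (totalDegree_dicksonQ_le (p := p))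
      omega
    have hk0 : replaceVar 0 0 (f - dicksonInv p k) = 0 := by
      rw [map_sub, sub_eq_zero, hk, map_sum, map_sum]
      ext e
      rw [coeff_replaceVar_zero, coeff_sum]
      have : ∀ d ∈ f.support.filter (· 0 = 0), coeff e (replaceVar 0 0 (dicksonInv p
          (C (coeff d f) * X 1 ^ (d 1 / (p * (p - 1))) * X 2 ^ d 2))) =
          if d = e then coeff d f else 0 := fun d hd => by
        rw [Finset.mem_filter] at hd
        have h2 := Nat.mul_div_cancel' (dvd_of_coeff_ne_zero_of_invariant hf
          (mem_support_iff.1 hd.1) hd.2)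
        rw [← coeff_monomial, monomial_eq, Finsupp.prod_fintype _ _ (fun _ => by simp),
          Fin.prod_univ_three, hd.2]
        congr 1
        simp [dicksonInv, replaceVar, dicksonQ, dicksonN, show p - 1 ≠ 0 by omega,
          show p ≠ 0 by omega, ← pow_mul, h2]
        ring
      rw [Finset.sum_congr rfl this, Finset.sum_ite_eq']
      by_cases he : e 0 = 0 <;> simp +contextual [he]
    have hki : ∀ M : Matrix (Fin 2) (Fin 2) (ZMod p), M.det = 1 →
        blockAct M (f - dicksonInv p k) = f - dicksonInv p k := fun M hM => by
      rw [map_sub, hf M hM, blockAct_dicksonInv hM]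
    obtain ⟨q, hq⟩ := dicksonL_dvd_of_invariant hki hk0
    by_cases hq0 : q = 0
    · exact ⟨k, by rw [eq_comm, ← sub_eq_zero, hq, hq0, mul_zero]⟩
    have hdeg : q.totalDegree < n := by
      have h1 := (totalDegree_sub f (dicksonInv p k)).trans (max_le hn.le hkdeg)
      have hN : dicksonN p ≠ 0 := right_ne_zero_of_mul dicksonL_ne_zero
      rw [hq, totalDegree_mul_of_isDomain dicksonL_ne_zero hq0, dicksonL,
        totalDegree_mul_of_isDomain (X_ne_zero _) hN, totalDegree_X] at h1
      omega
    obtain ⟨g, hg⟩ := ih _ hdeg q (fun M hM => by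
      have := hki M hM
      rw [hq, _root_.map_mul, blockAct_dicksonL, hM, C_1, one_mul] at this
      exact mul_left_cancel₀ dicksonL_ne_zero this) rfl
    refine ⟨X 0 * g + k, ?_⟩
    rw [_root_.map_add, _root_.map_mul, hg, ← eq_sub_iff_add_eq, hq]
    simp [dicksonInv]

end DicksonInvariants

section Modular

variable {p : ℕ} [Fact p.Prime]

theorem IsFrobeniusForm.finite {A B : Type*} [CommRing A] [CommRing B]
    {φ : A →+* B} {τ : B →+ A} (h : IsFrobeniusForm φ τ) : φ.Finite := by
  obtain ⟨ι, _, b, c, hbc⟩ := h.exists_dual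
  let _ := φ.toAlgebra
  refine Module.finite_def.2 (Submodule.fg_def.2 ⟨Set.range b, Set.finite_range b, ?_⟩)
  refine eq_top_iff.2 fun s _ => ?_
  rw [← hbc s]
  exact Submodule.sum_mem _ fun i _ => Submodule.smul_mem _ (τ (s * c i))
    (Submodule.subset_span ⟨i, rfl⟩)

theorem injective_of_injective_comp_of_finite {A B C : Type*} [CommRing A] [CommRing B] [IsDomain B]
    [CommRing C] {φ : A →+* B} (hφ : φ.Finite) {ψ : B →+* C}
    (h : Function.Injective (ψ.comp φ)) : Function.Injective ψ := by
  let _ := φ.toAlgebra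
  have : Module.Finite A B := hφ
  have : Nontrivial A := φ.domain_nontrivial
  have hi : Function.Injective φ := fun a b hab => h (congrArg ψ hab)
  rw [RingHom.injective_iff_ker_eq_bot] at h ⊢
  apply Ideal.eq_bot_of_comap_eq_bot (R := A)
  exact h

variable (p) in
/-- The inclusion of the subring generated by `X 0 ^ (p - 1)`, `X 1` and `X 2 ^ (p - 1)`. -/
def torusParam : MvPolynomial (Fin 3) (ZMod p) →ₐ[ZMod p] MvPolynomial (Fin 3) (ZMod p) :=
  aeval ![X 0 ^ (p - 1), X 1, X 2 ^ (p - 1)]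

theorem exists_isFrobeniusForm_torusParam : ∃ τ : MvPolynomial (Fin 3) (ZMod p) →+ _,
    IsFrobeniusForm (torusParam p).toRingHom τ ∧ τ (X 0 ^ (p - 1 - 1) * X 2 ^ (p - 1 - 1)) = 1 := by
  have hp := (Fact.out : p.Prime).one_lt
  have h (i : Fin 3) := exists_isFrobeniusForm_update (F := ZMod p) i (X i ^ (p - 1)) (p - 1)
    (by omega)
    (by simp only [map_pow, aeval_X, Function.update_self]
        exact Polynomial.monic_X_pow_sub_C _ (by omega))
    (by simp only [map_pow, aeval_X, Function.update_self]
        exact Polynomial.natDegree_X_pow_sub_C)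
  obtain ⟨τ₁, h₁, h₁'⟩ := h 2
  obtain ⟨τ₂, h₂, h₂'⟩ := h 0
  have hc := h₂.comp h₁
  set φ₁ : MvPolynomial (Fin 3) (ZMod p) →ₐ[ZMod p] MvPolynomial (Fin 3) (ZMod p) :=
    aeval (Function.update X 2 (X 2 ^ (p - 1)))
  set φ₂ : MvPolynomial (Fin 3) (ZMod p) →ₐ[ZMod p] MvPolynomial (Fin 3) (ZMod p) :=
    aeval (Function.update X 0 (X 0 ^ (p - 1)))
  have hφ : φ₂.toRingHom.comp φ₁.toRingHom = (torusParam p).toRingHom := by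
    have : φ₂.comp φ₁ = torusParam p := by
      apply MvPolynomial.algHom_ext
      intro i
      fin_cases i <;> simp [φ₁, φ₂, torusParam]
    rw [← this]; rfl
  rw [hφ] at hc
  refine ⟨_, hc, ?_⟩
  have e2 : (X 0 ^ (p - 1 - 1) * X 2 ^ (p - 1 - 1) : MvPolynomial (Fin 3) (ZMod p))
      = φ₂ (X 2 ^ (p - 1 - 1)) * X 0 ^ (p - 1 - 1) := by
    simp [φ₂]; ring
  have m2 := h₂.map_mul (X 2 ^ (p - 1 - 1)) (X 0 ^ (p - 1 - 1))
  rw [h₂', mul_one] at m2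
  change τ₁ (τ₂ _) = 1
  rw [e2]
  erw [m2]
  exact h₁'

theorem dicksonInv_injective : Function.Injective (dicksonInv p) := by
  obtain ⟨τ, h, -⟩ := exists_isFrobeniusForm_torusParam (p := p)
  obtain ⟨τ', h', h1'⟩ := exists_isFrobeniusForm_dicksonParam (p := p)
  refine injective_of_injective_comp_of_finite h.finite (ψ := (dicksonInv p).toRingHom) ?_
  let ν : MvPolynomial (Fin 3) (ZMod p) →ₐ[ZMod p] MvPolynomial (Fin 3) (ZMod p) :=
    aeval ![-X 0, X 1, X 2]
  have hν : ν.comp ν = AlgHom.id _ _ := by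
    apply MvPolynomial.algHom_ext
    intro i
    fin_cases i <;> simp [ν]
  have e : (dicksonInv p).comp (torusParam p) = (dicksonParam p).comp ν := by
    apply MvPolynomial.algHom_ext
    intro i
    fin_cases i <;> simp [ν, dicksonInv, torusParam, dicksonParam]
  have hi : Function.Injective ν := fun a b hab => by
    have := congrArg ν hab
    rwa [← AlgHom.comp_apply, ← AlgHom.comp_apply, hν] at this
  have : Function.Injective ((dicksonParam p).comp ν) := (h'.injective h1').comp hi
  rw [← e] at this
  exact this

/-- The action of a scalar on the ring of Dickson invariants. -/
def torusAct (c : ZMod p) :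
    MvPolynomial (Fin 3) (ZMod p) →ₐ[ZMod p] MvPolynomial (Fin 3) (ZMod p) :=
  aeval ![C c * X 0, X 1, C c⁻¹ * X 2]

theorem torusAct_mul (c d : ZMod p) (f) : torusAct c (torusAct d f) = torusAct (d * c) f := by
  have : (torusAct c).comp (torusAct d) = torusAct (d * c) := by
    apply MvPolynomial.algHom_ext
    intro i
    fin_cases i <;> simp [torusAct, mul_comm, mul_left_comm]
  exact DFunLike.congr_fun this f

theorem torusAct_one (f) : torusAct (1 : ZMod p) f = f := by
  have : torusAct (1 : ZMod p) = AlgHom.id _ _ := by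
    apply MvPolynomial.algHom_ext
    intro i
    fin_cases i <;> simp [torusAct]
  exact DFunLike.congr_fun this f

theorem torusAct_torusParam {c : ZMod p} (hc : c ≠ 0) (f) :
    torusAct c (torusParam p f) = torusParam p f := by
  have : (torusAct c).comp (torusParam p) = torusParam p := by
    apply MvPolynomial.algHom_ext
    intro i
    fin_cases i
    · simp [torusAct, torusParam, mul_pow, ← C_pow, ZMod.pow_card_sub_one_eq_one hc]
    · simp [torusAct, torusParam]
    · simp [torusAct, torusParam, mul_pow, ← C_pow, ZMod.pow_card_sub_one_eq_one hc, inv_pow]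
  exact DFunLike.congr_fun this f

theorem torusAct_X_pow_mul_X_pow {c : ZMod p} (hc : c ≠ 0) (n : ℕ) :
    torusAct c (X 0 ^ n * X 2 ^ n) = X 0 ^ n * X 2 ^ n := by
  have : C c ^ n * C c⁻¹ ^ n = (1 : MvPolynomial (Fin 3) (ZMod p)) := by
    rw [← mul_pow, ← C_mul, mul_inv_cancel₀ hc, C_1, one_pow]
  calc torusAct c (X 0 ^ n * X 2 ^ n) = (C c ^ n * C c⁻¹ ^ n) * (X 0 ^ n * X 2 ^ n) := by
        simp only [torusAct, _root_.map_mul, map_pow, aeval_X, Matrix.cons_val]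
        ring
    _ = _ := by rw [this, one_mul]

theorem exists_isFrobeniusForm_of_forall_det_eq_one (H : Subgroup (GL (Fin 2) (ZMod p)))
    (hH : ∀ h : GL (Fin 2) (ZMod p), (h : Matrix (Fin 2) (Fin 2) (ZMod p)).det = 1 → h ∈ H) :
    ∃ (φ : MvPolynomial (Fin 3) (ZMod p) →+* blockInv H) (τ : blockInv H →+ _),
      IsFrobeniusForm φ τ := by
  have hp := (Fact.out : p.Prime).one_lt
  obtain ⟨τ, h, h1⟩ := exists_isFrobeniusForm_torusParam (p := p)
  let Γ := H.map GeneralLinearGroup.det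
  have := Fintype.ofFinite Γ
  have hcard : ¬ p ∣ Nat.card Γ := fun hd => by
    have h2 := hd.trans (Subgroup.card_subgroup_dvd_card Γ)
    rw [Nat.card_eq_fintype_card, ZMod.card_units] at h2
    exact absurd (Nat.le_of_dvd (by omega) h2) (by omega)
  obtain ⟨c, hc⟩ := exists_C_mul_card _ hcard
  rw [Nat.card_eq_fintype_card] at hc
  have hle : blockInv H ≤ (dicksonInv p).range := fun f hf =>
    exists_dicksonInv_eq f fun M hM =>
      hf (GeneralLinearGroup.mkOfDetNeZero M (by rw [hM]; exact one_ne_zero)) (hH _ hM)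
  let e := AlgEquiv.ofInjective (dicksonInv p) dicksonInv_injective
  let j : blockInv H →ₐ[ZMod p] MvPolynomial (Fin 3) (ZMod p) :=
    (e.symm : _ →ₐ[ZMod p] _).comp (Subalgebra.inclusion hle)
  have hj : ∀ r, dicksonInv p (j r) = r := fun r =>
    congrArg Subtype.val (e.apply_symm_apply (Subalgebra.inclusion hle r))
  have hdet : ∀ (g : GL (Fin 2) (ZMod p)) (b), blockAct (g : Matrix (Fin 2) (Fin 2) (ZMod p))
      (dicksonInv p b) = dicksonInv p (torusAct (GeneralLinearGroup.det g : ZMod p) b) :=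
    fun g b => blockAct_dicksonInv_of_det (det_coe_ne_zero g) b
  refine h.exists_average (Γ := Γ) (fun g => (torusAct ((g : (ZMod p)ˣ) : ZMod p)).toRingHom)
    (fun g k b => torusAct_mul _ _ b) j.toRingHom ?_ ?_ c hc
    (fun a g => torusAct_torusParam (Units.ne_zero _) a) (fun g b => ?_)
  · intro a b hab
    apply Subtype.ext
    rw [← hj, ← hj]
    exact congrArg _ hab
  · refine fun b => ⟨?_, fun hb => ⟨⟨dicksonInv p b, fun g hg => ?_⟩, ?_⟩⟩
    · rintro ⟨r, rfl⟩ ⟨_, g, hg, rfl⟩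
      apply dicksonInv_injective
      refine (hdet g (j r)).symm.trans ?_
      rw [hj]
      exact (r.2 g hg).trans (hj r).symm
    · rw [hdet]
      exact congrArg _ (hb ⟨_, g, hg, rfl⟩)
    · exact dicksonInv_injective (hj _)
  · refine h.apply_eq_of_apply_eq (torusAct ((g : (ZMod p)ˣ) : ZMod p))
      (torusAct ((g : (ZMod p)ˣ) : ZMod p)⁻¹)
      (fun b => ?_) (fun b => ?_) (torusAct_torusParam (Units.ne_zero _)) h1
      (torusAct_X_pow_mul_X_pow (Units.ne_zero _) _) b
    · rw [torusAct_mul, inv_mul_cancel₀ (Units.ne_zero _), torusAct_one]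
    · rw [torusAct_mul, mul_inv_cancel₀ (Units.ne_zero _), torusAct_one]

end Modular

section GeneralLinear

variable {p : ℕ} [Fact p.Prime]

theorem mem_of_elementary_mem (K : Subgroup (GL (Fin 2) (ZMod p))) {c d : ZMod p} (hc : c ≠ 0)
    (hd : d ≠ 0) {g k : GL (Fin 2) (ZMod p)} (hg : g ∈ K) (hk : k ∈ K)
    (hgc : g.1 = !![1, 0; c, 1]) (hkd : k.1 = !![1, d; 0, 1]) (m : GL (Fin 2) (ZMod p))
    (hm : m.1.det = 1) : m ∈ K := by
  have hL : ∀ a, ∃ l ∈ K, l.1 = !![1, 0; a, 1] := fun a => by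
    have : ∀ n : ℕ, (g ^ n).1 = !![1, 0; n * c, 1] := fun n => by
      induction n with
      | zero => simp [Matrix.one_fin_two]
      | succ n ih =>
        rw [pow_succ, Units.val_mul, ih, hgc]
        simp [add_mul]
    refine ⟨g ^ (a / c).val, pow_mem hg _, ?_⟩
    rw [this, ZMod.natCast_zmod_val, div_mul_cancel₀ _ hc]
  have hU : ∀ a, ∃ l ∈ K, l.1 = !![1, a; 0, 1] := fun a => by
    have : ∀ n : ℕ, (k ^ n).1 = !![1, n * d; 0, 1] := fun n => by
      induction n with
      | zero => simp [Matrix.one_fin_two]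
      | succ n ih =>
        rw [pow_succ, Units.val_mul, ih, hkd]
        simp [add_mul, add_comm]
    refine ⟨k ^ (a / d).val, pow_mem hk _, ?_⟩
    rw [this, ZMod.natCast_zmod_val, div_mul_cancel₀ _ hd]
  have key : ∀ m : GL (Fin 2) (ZMod p), m.1.det = 1 → m.1 1 0 ≠ 0 → m ∈ K := fun m hm h0 => by
    obtain ⟨x, hx, hx'⟩ := hU ((m.1 0 0 - 1) / m.1 1 0)
    obtain ⟨y, hy, hy'⟩ := hL (m.1 1 0)
    obtain ⟨z, hz, hz'⟩ := hU ((m.1 1 1 - 1) / m.1 1 0)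
    have : m = x * y * z := by
      ext1
      rw [Units.val_mul, Units.val_mul, hx', hy', hz']
      rw [det_fin_two] at hm
      have h01 : m.1 0 1 = (m.1 0 0 * m.1 1 1 - 1) / m.1 1 0 := by
        rw [eq_div_iff h0, ← hm]; ring
      ext i j
      fin_cases i <;> fin_cases j <;> simp [h01] <;> field_simp <;> ring
    rw [this]
    exact mul_mem (mul_mem hx hy) hz
  by_cases h0 : m.1 1 0 = 0
  · obtain ⟨l, hl, hl'⟩ := hL 1
    have h00 : m.1 0 0 ≠ 0 := fun h => by
      rw [det_fin_two, h0, h] at hm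
      simp at hm
    have := key (l * m) (by rw [Units.val_mul, det_mul, hm, hl']; simp [det_fin_two])
      (by rw [Units.val_mul, hl']; simpa [Matrix.mul_apply, Fin.sum_univ_two, h0] using h00)
    exact (K.mul_mem_cancel_left hl).1 this
  · exact key m hm h0

theorem sub_one_mul_sub_one_eq_zero {M : Matrix (Fin 2) (Fin 2) (ZMod p)} (hM : M ^ p = 1) :
    (M - 1) * (M - 1) = 0 := by
  have h : (M - 1) ^ p = 0 := by
    rw [sub_pow_char_of_commute p (Commute.one_right M), hM, one_pow, sub_self]
  have ht := (Matrix.isNilpotent_trace_of_isNilpotent (⟨p, h⟩ : IsNilpotent (M - 1))).eq_zero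
  have hd : (M - 1).det = 0 := by
    have := congrArg det h
    rw [det_pow, det_zero] at this
    exact pow_eq_zero_iff (Fact.out : p.Prime).ne_zero |>.1 this
  generalize M - 1 = n at ht hd
  rw [trace_fin_two] at ht
  rw [det_fin_two] at hd
  rw [Matrix.eta_fin_two n, Matrix.mul_fin_two]
  ext i j
  fin_cases i <;> fin_cases j <;> simp
  · linear_combination n 0 0 * ht - hd
  · linear_combination n 0 1 * ht
  · linear_combination n 1 0 * ht
  · linear_combination n 1 1 * ht - hd

theorem mem_of_det_eq_one_of_dvd_card (H : Subgroup (GL (Fin 2) (ZMod p)))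
    (hirr : ∀ v : Fin 2 → ZMod p, v ≠ 0 → ∃ h ∈ H, (Matrix.of ![v, v ᵥ* h.1]).det ≠ 0)
    (hp : p ∣ Nat.card H) (m : GL (Fin 2) (ZMod p)) (hm : m.1.det = 1) : m ∈ H := by
  have := Fintype.ofFinite H
  obtain ⟨⟨u, hu⟩, hord⟩ := exists_prime_orderOf_dvd_card' p hp
  rw [Subgroup.orderOf_mk] at hord
  have hup' : u ^ p = 1 := orderOf_dvd_iff_pow_eq_one.1 hord.dvd
  have hup : u.1 ^ p = 1 := by rw [← Units.val_pow_eq_pow_val, hup', Units.val_one]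
  have hu1 : u ≠ 1 := fun h => by
    rw [h, orderOf_one] at hord
    exact (Fact.out : p.Prime).one_lt.ne hord
  have hn := sub_one_mul_sub_one_eq_zero hup
  have hn0 : u.1 - 1 ≠ 0 := fun h => hu1 (Units.ext (sub_eq_zero.1 h))
  obtain ⟨i, hi⟩ : ∃ i, (u.1 - 1) i ≠ 0 := by
    by_contra! h
    exact hn0 (funext h)
  set v := (u.1 - 1) i with hv
  have hvu : v ᵥ* u.1 = v := by
    have h1 : v ᵥ* (u.1 - 1) = 0 := by
      rw [hv, ← Matrix.mul_apply_eq_vecMul, hn]; rfl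
    rwa [vecMul_sub, vecMul_one, sub_eq_zero] at h1
  obtain ⟨h, hh, hdet⟩ := hirr v hi
  set g := GeneralLinearGroup.mkOfDetNeZero _ hdet with hg
  have hg0 : g.1 0 = v := rfl
  have hg1 : g.1 1 = v ᵥ* h.1 := rfl
  have hginj : Function.Injective fun x => x ᵥ* g.1 := vecMul_injective_of_isUnit g.isUnit
  have conj_apply : ∀ (x : GL (Fin 2) (ZMod p)) (j), (g * x * g⁻¹).1 j ᵥ* g.1 = g.1 j ᵥ* x.1 :=
    fun x j => by
      rw [← Matrix.mul_apply_eq_vecMul, ← Matrix.mul_apply_eq_vecMul, ← Units.val_mul,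
        inv_mul_cancel_right]
      rfl
  have conj_one : ∀ x : GL (Fin 2) (ZMod p), x ≠ 1 → (g * x * g⁻¹).1 ≠ 1 := fun x hx h1 => by
    have : g * x * g⁻¹ = 1 := Units.ext h1
    rw [mul_inv_eq_one, mul_eq_left] at this
    exact hx this
  have conj_pow : ∀ x : GL (Fin 2) (ZMod p), x ^ p = 1 → (g * x * g⁻¹).1 ^ p = 1 := fun x hx => by
    rw [← Units.val_pow_eq_pow_val, conj_pow, hx]
    simp
  have hA0 : (g * u * g⁻¹).1 0 = ![1, 0] := hginj <| by
    beta_reduce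
    rw [conj_apply, hg0, hvu]
    ext j
    simp [vecMul, dotProduct, Fin.sum_univ_two, ← hg0]
  have hB1 : (g * (h⁻¹ * u * h) * g⁻¹).1 1 = ![0, 1] := hginj <| by
    beta_reduce
    rw [conj_apply, hg1, vecMul_vecMul, ← Units.val_mul]
    have : h * (h⁻¹ * u * h) = u * h := by group
    rw [this, Units.val_mul, ← vecMul_vecMul, hvu, ← hg1]
    ext j
    simp [vecMul, dotProduct, Fin.sum_univ_two]
  have hA1 := conj_one u hu1
  have hA2 := sub_one_mul_sub_one_eq_zero (conj_pow u hup')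
  have hB0 := conj_one (h⁻¹ * u * h) (fun h1 => hu1 (by
    rw [mul_eq_one_iff_eq_inv, mul_eq_left] at h1; exact h1))
  have hB2 := sub_one_mul_sub_one_eq_zero (conj_pow (h⁻¹ * u * h) (by
    have := _root_.conj_pow (i := p) (a := h⁻¹) (b := u)
    rw [inv_inv] at this
    rw [this, hup']; simp))
  have hAK : g * u * g⁻¹ ∈ H.map (MulAut.conj g).toMonoidHom := ⟨u, hu, rfl⟩
  have hBK : g * (h⁻¹ * u * h) * g⁻¹ ∈ H.map (MulAut.conj g).toMonoidHom :=
    ⟨_, mul_mem (mul_mem (inv_mem hh) hu) hh, rfl⟩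
  generalize g * u * g⁻¹ = A at hA0 hA1 hA2 hAK
  generalize g * (h⁻¹ * u * h) * g⁻¹ = B at hB0 hB1 hB2 hBK
  have hA : A.1 = !![1, 0; A.1 1 0, 1] := by
    have h11 := congrFun (congrFun hA2 1) 1
    simp [Matrix.mul_apply, Fin.sum_univ_two, hA0] at h11
    rw [Matrix.eta_fin_two A.1, hA0, sub_eq_zero.1 h11]
    simp
  have hB : B.1 = !![1, B.1 0 1; 0, 1] := by
    have h11 := congrFun (congrFun hB2 0) 0
    simp [Matrix.mul_apply, Fin.sum_univ_two, hB1] at h11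
    rw [Matrix.eta_fin_two B.1, hB1, sub_eq_zero.1 h11]
    simp
  have hm' := mem_of_elementary_mem _ (c := A.1 1 0) (d := B.1 0 1)
    (fun h => hA1 (by rw [hA, h, Matrix.one_fin_two]))
    (fun h => hB0 (by rw [hB, h, Matrix.one_fin_two])) hAK hBK hA hB (g * m * g⁻¹) (by
      rw [Units.val_mul, Units.val_mul, det_mul_comm, ← mul_assoc, ← Units.val_mul, inv_mul_cancel,
        Units.val_one, one_mul, hm])
  obtain ⟨y, hy, hym⟩ := hm'
  have : y = m := (MulAut.conj g).injective hym
  exact this ▸ hy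

theorem exists_isFrobeniusForm_blockInv (H : Subgroup (GL (Fin 2) (ZMod p)))
    (hirr : ∀ v : Fin 2 → ZMod p, v ≠ 0 → ∃ h ∈ H, (Matrix.of ![v, v ᵥ* h.1]).det ≠ 0) :
    ∃ (φ : MvPolynomial (Fin 3) (ZMod p) →+* blockInv H) (τ : blockInv H →+ _),
      IsFrobeniusForm φ τ := by
  by_cases hp : p ∣ Nat.card H
  · exact exists_isFrobeniusForm_of_forall_det_eq_one H fun h hh =>
      mem_of_det_eq_one_of_dvd_card H hirr hp h hh
  · exact exists_isFrobeniusForm_of_not_dvd H hp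

end GeneralLinear

theorem mul_order_three_matrix : ∀ k : Matrix (Fin 2) (Fin 2) (ZMod 2), k.det ≠ 0 →
    k * !![0, 1; 1, 1] = !![0, 1; 1, 1] * k ∨
    k * !![0, 1; 1, 1] = !![0, 1; 1, 1] * !![0, 1; 1, 1] * k := by decide

theorem det_order_three_matrix : (!![0, 1; 1, 1] : Matrix (Fin 2) (Fin 2) (ZMod 2)).det = 1 := by
  decide

theorem det_one_sub_order_three_matrix :
    (1 - !![0, 1; 1, 1] : Matrix (Fin 2) (Fin 2) (ZMod 2)).det ≠ 0 := by
  decide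

section Cocycle

variable {p : ℕ} [Fact p.Prime] {H : Subgroup (GL (Fin 2) (ZMod p))}
  {W : H → Fin 2 → ZMod p}

theorem exists_coboundary_of_not_dvd (hH : ¬ p ∣ Nat.card H)
    (hW : ∀ h k : H, W (h * k) = W h ᵥ* k.1.1 + h.1.1.det⁻¹ • W k) :
    ∃ v, ∀ h : H, W h = h.1.1.det⁻¹ • v - v ᵥ* h.1.1 := by
  have := Fintype.ofFinite H
  have hc : (Fintype.card H : ZMod p) ≠ 0 := by
    rwa [Ne, ZMod.natCast_eq_zero_iff, ← Nat.card_eq_fintype_card]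
  have hd : ∀ h : H, h.1.1.det ≠ 0 := fun h => det_coe_ne_zero h.1
  set S := ∑ h : H, h.1.1.det • W h with hS
  refine ⟨(Fintype.card H : ZMod p)⁻¹ • S, fun k => ?_⟩
  have h1 : S = k.1.1.det • (S ᵥ* k.1.1) + (Fintype.card H : ZMod p) • (k.1.1.det • W k) := by
    calc S = ∑ h : H, (h * k).1.1.det • W (h * k) :=
          (Equiv.sum_comp (Equiv.mulRight k) fun h : H => h.1.1.det • W h).symm
      _ = ∑ h : H, (k.1.1.det • ((h.1.1.det • W h) ᵥ* k.1.1) + k.1.1.det • W k) := by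
          refine Finset.sum_congr rfl fun h _ => ?_
          have : (h * k).1.1.det = h.1.1.det * k.1.1.det := det_mul _ _
          rw [hW, this, smul_add, smul_smul, mul_right_comm, mul_inv_cancel₀ (hd h), one_mul,
            smul_vecMul, smul_smul, mul_comm]
      _ = _ := by
          rw [Finset.sum_add_distrib, Finset.sum_const, Finset.card_univ, ← Finset.smul_sum,
            ← Nat.cast_smul_eq_nsmul (ZMod p), hS, Matrix.sum_vecMul]
  rw [smul_vecMul, smul_comm, ← smul_sub]
  nth_rewrite 1 [h1]
  rw [smul_add, smul_smul, inv_mul_cancel₀ (hd k), one_smul, add_sub_cancel_left,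
    smul_smul _ _ (W k),
    smul_smul, smul_smul]
  field_simp [hd k]
  simp

theorem exists_coboundary_of_commute {z : H} (hz : z.1.1.det = 1) (hz1 : IsUnit (1 - z.1.1))
    (hcomm : ∀ k : H, k * z = z * k ∨ k * z = z * z * k)
    (hW : ∀ h k : H, W (h * k) = W h ᵥ* k.1.1 + h.1.1.det⁻¹ • W k) :
    ∃ v, ∀ h : H, W h = h.1.1.det⁻¹ • v - v ᵥ* h.1.1 := by
  obtain ⟨y, -, hy⟩ := isUnit_iff_exists.1 hz1
  set v := W z ᵥ* y with hv
  have hWz : W z = v - v ᵥ* z.1.1 := by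
    have : v ᵥ* (1 - z.1.1) = W z := by rw [hv, vecMul_vecMul, hy, vecMul_one]
    rw [← this, vecMul_sub, vecMul_one]
  set W' : H → Fin 2 → ZMod p := fun h => W h - (h.1.1.det⁻¹ • v - v ᵥ* h.1.1) with hW'
  have hcoc : ∀ h k : H, W' (h * k) = W' h ᵥ* k.1.1 + h.1.1.det⁻¹ • W' k := fun h k => by
    have hd : (h.1.1 * k.1.1).det = h.1.1.det * k.1.1.det := det_mul _ _
    have hm : (h * k).1.1 = h.1.1 * k.1.1 := rfl
    simp only [hW', hW h k, hm, hd, mul_inv, sub_vecMul, smul_vecMul, vecMul_vecMul]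
    module
  have hz0 : W' z = 0 := by simp [hW', hWz, hz]
  have hzz : W' (z * z) = 0 := by rw [hcoc, hz0]; simp
  have hzk : ∀ k, W' (z * k) = W' k := fun k => by rw [hcoc, hz0, hz]; simp
  have hzzk : ∀ k, W' (z * z * k) = W' k := fun k => by rw [mul_assoc, hzk, hzk]
  refine ⟨v, fun k => ?_⟩
  have h1 : W' k ᵥ* z.1.1 = W' k := by
    have h2 := hcoc k z
    rw [hz0, smul_zero, add_zero] at h2
    rw [← h2]
    rcases hcomm k with h | h
    · rw [h, hzk]
    · rw [h, hzzk]
  have h3 : W' k = 0 := by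
    apply vecMul_injective_of_isUnit hz1
    simp [vecMul_sub, h1]
  exact sub_eq_zero.1 h3

theorem exists_coboundary
    (hirr : ∀ v : Fin 2 → ZMod p, v ≠ 0 → ∃ h ∈ H, (Matrix.of ![v, v ᵥ* h.1]).det ≠ 0)
    (hW : ∀ h k : H, W (h * k) = W h ᵥ* k.1.1 + h.1.1.det⁻¹ • W k) :
    ∃ v, ∀ h : H, W h = h.1.1.det⁻¹ • v - v ᵥ* h.1.1 := by
  by_cases hH : p ∣ Nat.card H
  · have hmem := mem_of_det_eq_one_of_dvd_card H hirr hH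
    by_cases hp : p = 2
    · subst hp
      set z : GL (Fin 2) (ZMod 2) :=
        GeneralLinearGroup.mk'' !![0, 1; 1, 1] (det_order_three_matrix ▸ isUnit_one)
      have hd : z.1.det = 1 := det_order_three_matrix
      refine exists_coboundary_of_commute (z := ⟨z, hmem z hd⟩) hd ?_ (fun k => ?_) hW
      · rw [isUnit_iff_isUnit_det, isUnit_iff_ne_zero]
        exact det_one_sub_order_three_matrix
      · refine (mul_order_three_matrix k.1.1 (det_coe_ne_zero k.1)).imp (fun h => ?_)
          fun h => ?_ <;>
        exact Subtype.ext (Units.ext h)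
    · have hd : (-1 : GL (Fin 2) (ZMod p)).1.det = 1 := by simp [det_neg]
      refine exists_coboundary_of_commute (z := ⟨-1, hmem _ hd⟩) hd ?_ (fun k => Or.inl ?_) hW
      · rw [isUnit_iff_isUnit_det, isUnit_iff_ne_zero]
        have h2 : (2 : ZMod p) ≠ 0 := by
          have := (ZMod.natCast_eq_zero_iff 2 p).not.2 fun h =>
            hp ((Nat.prime_dvd_prime_iff_eq Fact.out Nat.prime_two).1 h)
          exact_mod_cast this
        have : (1 - (-1 : GL (Fin 2) (ZMod p)).1) = (2 : ZMod p) • 1 := by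
          rw [Units.val_neg, Units.val_one, sub_neg_eq_add, two_smul]
        rw [this, det_smul]
        simpa using h2
      · exact Subtype.ext (by simp)
  · exact exists_coboundary_of_not_dvd hH hW

end Cocycle

section Affine

theorem replaceVar_prod_X_sub_injective {σ F : Type*} [Field F] [DecidableEq σ] {i : σ}
    (Λ : Finset (MvPolynomial σ F)) (hne : Λ.Nonempty) (hΛ : ∀ w ∈ Λ, replaceVar i 0 w = w) :
    Function.Injective (replaceVar i (∏ w ∈ Λ, (X i - w))) := by
  set ψ : MvPolynomial σ F →ₐ[F] Polynomial (MvPolynomial σ F) :=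
    aeval (Function.update (fun j => Polynomial.C (X j)) i Polynomial.X) with hψ
  have hC : ∀ w, ψ (replaceVar i 0 w) = Polynomial.C (replaceVar i 0 w) := fun w => by
    have : ψ.comp (replaceVar i 0) = (Polynomial.CAlgHom).comp (replaceVar i 0) := by
      apply MvPolynomial.algHom_ext
      intro j
      by_cases h : j = i
      · subst h; simp
      · simp [replaceVar_X_of_ne h, hψ, h]
    exact DFunLike.congr_fun this w
  have hP : ψ (∏ w ∈ Λ, (X i - w)) = ∏ w ∈ Λ, (Polynomial.X - Polynomial.C w) := by
    rw [map_prod]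
    refine Finset.prod_congr rfl fun w hw => ?_
    rw [map_sub, ← hΛ w hw, hC]
    simp [hψ]
  have hcard : 0 < Λ.card := hne.card_pos
  have hdeg : (ψ (∏ w ∈ Λ, (X i - w))).natDegree = Λ.card := by
    rw [hP, Polynomial.natDegree_finsetProd_X_sub_C_eq_card]
  obtain ⟨hm, hd⟩ := monic_natDegree_sub (P := ψ (∏ w ∈ Λ, (X i - w))) (r := Polynomial.C (X i))
    (hP ▸ Polynomial.monic_prod_X_sub_C (fun w => w) Λ)
    (by rw [hdeg, Polynomial.natDegree_C]; exact hcard)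
  obtain ⟨τ, h, h1⟩ := exists_isFrobeniusForm_update i _ _ hcard hm (hd.trans hdeg)
  exact h.injective h1

theorem polyAct_polyAct {F : Type u} [CommSemiring F] {m : ℕ} (M N : Matrix (Fin m) (Fin m) F)
    (f : MvPolynomial (Fin m) F) : polyAct M (polyAct N f) = polyAct (N * M) f := by
  have : (polyAct M).comp (polyAct N) = polyAct (N * M) := by
    apply MvPolynomial.algHom_ext
    intro i
    simp only [polyAct, AlgHom.comp_apply, aeval_X, map_sum, map_smul, Finset.smul_sum,
      Matrix.mul_apply, Finset.sum_smul, smul_smul]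
    exact Finset.sum_comm
  exact DFunLike.congr_fun this f

theorem polyAct_one {F : Type u} [CommSemiring F] {m : ℕ} (f : MvPolynomial (Fin m) F) :
    polyAct 1 f = f := by
  have : polyAct (1 : Matrix (Fin m) (Fin m) F) = AlgHom.id _ _ := by
    apply MvPolynomial.algHom_ext
    intro i
    simp [polyAct, Matrix.one_apply]
  exact DFunLike.congr_fun this f

/-- Conjugating a family of matrices does not change its invariants up to isomorphism. -/
def invariantAlgConj {F : Type u} [CommSemiring F] {m : ℕ} {ι : Type*}
    (D : ι → Matrix (Fin m) (Fin m) F) {P Q : Matrix (Fin m) (Fin m) F} (hPQ : P * Q = 1)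
    (hQP : Q * P = 1) :
    invariantAlg (Set.range D) ≃+* invariantAlg (Set.range fun i => Q * D i * P) where
  toFun f := ⟨polyAct P f.1, by
    rintro _ ⟨i, rfl⟩
    have := f.2 _ ⟨i, rfl⟩
    rw [polyAct_polyAct, ← mul_assoc, ← mul_assoc, hPQ, one_mul, ← polyAct_polyAct, this]⟩
  invFun f := ⟨polyAct Q f.1, by
    rintro _ ⟨i, rfl⟩
    have := f.2 _ ⟨i, rfl⟩
    rw [polyAct_polyAct]
    nth_rewrite 2 [← this]
    rw [polyAct_polyAct, mul_assoc, hPQ, mul_one]⟩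
  left_inv f := Subtype.ext (by simp [polyAct_polyAct, hPQ, polyAct_one])
  right_inv f := Subtype.ext (by simp [polyAct_polyAct, hQP, polyAct_one])
  map_mul' f g := Subtype.ext (by simp)
  map_add' f g := Subtype.ext (by simp)

variable {p : ℕ} [Fact p.Prime]

/-- The lower block triangular `3 × 3` matrix of determinant one with upper left block `A` and
last row starting with `w`. -/
def affineMat (A : Matrix (Fin 2) (Fin 2) (ZMod p)) (w : Fin 2 → ZMod p) :
    Matrix (Fin 3) (Fin 3) (ZMod p) :=
  !![A 0 0, A 0 1, 0; A 1 0, A 1 1, 0; w 0, w 1, A.det⁻¹]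

theorem affineMat_mul (A B : Matrix (Fin 2) (Fin 2) (ZMod p)) (v w : Fin 2 → ZMod p) :
    affineMat A v * affineMat B w = affineMat (A * B) (v ᵥ* B + A.det⁻¹ • w) := by
  have hd : (A * B).det⁻¹ = A.det⁻¹ * B.det⁻¹ := by rw [det_mul, mul_inv]
  ext i j
  fin_cases i <;> fin_cases j <;>
    simp [affineMat, Matrix.mul_apply, Fin.sum_univ_three, Fin.sum_univ_two, vecMul, dotProduct,
      hd, -det_mul]

theorem affineMat_one_zero : affineMat (1 : Matrix (Fin 2) (Fin 2) (ZMod p)) 0 = 1 := by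
  ext i j
  fin_cases i <;> fin_cases j <;> simp [affineMat]

theorem polyAct_affineMat_zero (A : Matrix (Fin 2) (Fin 2) (ZMod p)) :
    polyAct (affineMat A 0) = blockAct A := by
  apply MvPolynomial.algHom_ext
  intro i
  fin_cases i <;> simp [polyAct, affineMat, blockAct, Fin.sum_univ_three, smul_eq_C_mul]

/-- The linear form in the first two variables with coefficients `u`. -/
def linForm (u : Fin 2 → ZMod p) : MvPolynomial (Fin 3) (ZMod p) := C (u 0) * X 0 + C (u 1) * X 1

theorem polyAct_affineMat_one (u : Fin 2 → ZMod p) :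
    polyAct (affineMat 1 u) = replaceVar 2 (X 2 + linForm u) := by
  apply MvPolynomial.algHom_ext
  intro i
  fin_cases i
  · simp [polyAct, affineMat, Fin.sum_univ_three, replaceVar]
  · simp [polyAct, affineMat, Fin.sum_univ_three, replaceVar]
  · simp [polyAct, affineMat, Fin.sum_univ_three, replaceVar, smul_eq_C_mul, linForm]
    ring

theorem linForm_injective : Function.Injective (linForm (p := p)) := fun u v h => by
  have h0 := congrArg (eval ![1, 0, 0]) h
  have h1 := congrArg (eval ![0, 1, 0]) h
  simp [linForm] at h0 h1
  ext i
  fin_cases i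
  · exact h0
  · exact h1

theorem linForm_add (u v : Fin 2 → ZMod p) : linForm (u + v) = linForm u + linForm v := by
  simp [linForm]; ring

theorem replaceVar_linForm (u : Fin 2 → ZMod p) (v) : replaceVar 2 v (linForm u) = linForm u := by
  simp [linForm, replaceVar]

/-- The product of all translates of the last variable by linear forms in the first two. -/
def translateProd (p : ℕ) [Fact p.Prime] : MvPolynomial (Fin 3) (ZMod p) :=
  ∏ w ∈ Finset.univ.image (linForm (p := p)), (X 2 - w)

theorem blockAct_translateProd {A : Matrix (Fin 2) (Fin 2) (ZMod p)} (hA : A.det ≠ 0) :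
    blockAct A (translateProd p) = C A.det⁻¹ * translateProd p := by
  have hbij : Function.Bijective fun u : Fin 2 → ZMod p => A.det • (u ᵥ* A) := by
    refine Finite.injective_iff_bijective.1 fun u v h => ?_
    exact vecMul_injective_of_isUnit ((isUnit_iff_isUnit_det A).2 hA.isUnit)
      (smul_right_injective _ hA h)
  have hlin : ∀ u : Fin 2 → ZMod p, blockAct A (X 2 - linForm u)
      = C A.det⁻¹ * (X 2 - linForm (A.det • (u ᵥ* A))) := fun u => by
    have hc : (C A.det⁻¹ * C A.det : MvPolynomial (Fin 3) (ZMod p)) = 1 := by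
      rw [← C_mul, inv_mul_cancel₀ hA, C_1]
    simp only [blockAct, linForm, map_sub, aeval_X, _root_.map_add, _root_.map_mul, vecMul,
      dotProduct, Fin.sum_univ_two, Pi.smul_apply, smul_eq_mul, algHom_C, algebraMap_eq]
    simp
    linear_combination (C (u 0) * (C (A 0 0) * X 0 + C (A 0 1) * X 1)
      + C (u 1) * (C (A 1 0) * X 0 + C (A 1 1) * X 1)) * hc
  have hpow : (A.det⁻¹) ^ Fintype.card (Fin 2 → ZMod p) = A.det⁻¹ := by
    rw [Fintype.card_fun, ZMod.card, Fintype.card_fin, pow_two, pow_mul, ZMod.pow_card,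
      ZMod.pow_card]
  rw [translateProd, Finset.prod_image linForm_injective.injOn, map_prod,
    Finset.prod_congr rfl fun u _ => hlin u, Finset.prod_mul_distrib, Finset.prod_const,
    Finset.card_univ, ← C_pow, hpow]
  congr 1
  exact hbij.prod_comp fun u => (X 2 - linForm u : MvPolynomial (Fin 3) (ZMod p))

theorem blockAct_replaceVar_translateProd {A : Matrix (Fin 2) (Fin 2) (ZMod p)} (hA : A.det ≠ 0)
    (f) : blockAct A (replaceVar 2 (translateProd p) f)
      = replaceVar 2 (translateProd p) (blockAct A f) := by
  have : (blockAct A).comp (replaceVar 2 (translateProd p))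
      = (replaceVar 2 (translateProd p)).comp (blockAct A) := by
    apply MvPolynomial.algHom_ext
    intro i
    fin_cases i
    · simp [blockAct, replaceVar]
    · simp [blockAct, replaceVar]
    · have h := blockAct_translateProd hA
      simp only [AlgHom.comp_apply, Fin.reduceFinMk, replaceVar_X_self, h]
      simp [blockAct]
  exact DFunLike.congr_fun this f

theorem zero_mem_image_linForm :
    (0 : MvPolynomial (Fin 3) (ZMod p)) ∈ Finset.univ.image (linForm (p := p)) :=
  Finset.mem_image.2 ⟨0, Finset.mem_univ _, by simp [linForm]⟩

theorem add_mem_image_linForm : ∀ u ∈ Finset.univ.image (linForm (p := p)),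
    ∀ w ∈ Finset.univ.image (linForm (p := p)), w + u ∈ Finset.univ.image (linForm (p := p)) := by
  simp only [Finset.mem_image, Finset.mem_univ, true_and]
  rintro _ ⟨u, rfl⟩ _ ⟨v, rfl⟩
  exact ⟨v + u, linForm_add v u⟩

theorem replaceVar_mem_image_linForm : ∀ w ∈ Finset.univ.image (linForm (p := p)),
    replaceVar 2 0 w = w := by
  simp only [Finset.mem_image, Finset.mem_univ, true_and]
  rintro _ ⟨u, rfl⟩
  exact replaceVar_linForm u 0

variable {Γ : Type*} [Group Γ] {A : Γ →* GL (Fin 2) (ZMod p)} {w : Γ → Fin 2 → ZMod p}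

theorem exists_isFrobeniusForm_of_forall_translation
    (hw : ∀ g k, w (g * k) = w g ᵥ* (A k).1 + (A g).1.det⁻¹ • w k)
    (hirr : ∀ v : Fin 2 → ZMod p, v ≠ 0 → ∃ g, (Matrix.of ![v, v ᵥ* (A g).1]).det ≠ 0)
    (hall : ∀ u, ∃ g, A g = 1 ∧ w g = u) :
    ∃ (φ : MvPolynomial (Fin 3) (ZMod p) →+*
        invariantAlg (Set.range fun g => affineMat (A g).1 (w g))) (τ : _ →+ _),
      IsFrobeniusForm φ τ := by
  set R := invariantAlg (Set.range fun g => affineMat (A g).1 (w g)) with hR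
  have hinj : Function.Injective (replaceVar 2 (translateProd p)) :=
    replaceVar_prod_X_sub_injective _ ⟨0, zero_mem_image_linForm⟩ replaceVar_mem_image_linForm
  have htrans : ∀ f ∈ R, ∀ u, replaceVar 2 (X 2 + linForm u) f = f := fun f hf u => by
    obtain ⟨g, hg, hu⟩ := hall u
    rw [← polyAct_affineMat_one]
    exact hf _ ⟨g, by simp [hg, hu]⟩
  have hblock : ∀ f ∈ R, ∀ g, blockAct (A g).1 f = f := fun f hf g => by
    obtain ⟨k, hk, hu⟩ := hall (-((A g).1.det • w g))
    rw [← polyAct_affineMat_zero]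
    refine hf _ ⟨g * k, ?_⟩
    have h0 : w (g * k) = 0 := by
      rw [hw, hk, hu, smul_neg, smul_smul, inv_mul_cancel₀ (det_coe_ne_zero _)]
      simp
    simp [h0, hk]
  have hmem : ∀ f ∈ blockInv A.range, replaceVar 2 (translateProd p) f ∈ R := fun f hf => by
    rintro _ ⟨g, rfl⟩
    have h : affineMat (A g).1 (w g)
        = affineMat (A g).1 0 * affineMat 1 ((A g).1.det • w g) := by
      rw [affineMat_mul, smul_smul, inv_mul_cancel₀ (det_coe_ne_zero _)]
      simp
    dsimp only
    rw [h, ← polyAct_polyAct, polyAct_affineMat_zero,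
      blockAct_replaceVar_translateProd (det_coe_ne_zero _), hf _ ⟨g, rfl⟩,
      polyAct_affineMat_one, replaceVar_comp]
    congr 2
    exact replaceVar_prod_X_sub _ add_mem_image_linForm replaceVar_mem_image_linForm
      (Finset.mem_image_of_mem _ (Finset.mem_univ _))
  let e : blockInv A.range →ₐ[ZMod p] R :=
    ((replaceVar 2 (translateProd p)).comp (blockInv A.range).val).codRestrict R
      fun f => hmem f.1 f.2
  have he : Function.Bijective e := by
    refine ⟨fun a b h => Subtype.ext (hinj (congrArg Subtype.val h)), fun f => ?_⟩
    obtain ⟨g, hg⟩ := exists_replaceVar_eq _ zero_mem_image_linForm add_mem_image_linForm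
      replaceVar_mem_image_linForm f.1 (by
        simp only [Finset.mem_image, Finset.mem_univ, true_and]
        rintro _ ⟨u, rfl⟩
        exact htrans f.1 f.2 u)
    refine ⟨⟨g, ?_⟩, Subtype.ext hg⟩
    rintro _ ⟨k, rfl⟩
    apply hinj
    rw [← blockAct_replaceVar_translateProd (det_coe_ne_zero _)]
    have : replaceVar 2 (translateProd p) g = f.1 := hg
    rw [this, hblock f.1 f.2]
  obtain ⟨φ, τ, h⟩ := exists_isFrobeniusForm_blockInv A.range fun v hv => by
    obtain ⟨g, hg⟩ := hirr v hv
    exact ⟨_, ⟨g, rfl⟩, hg⟩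
  exact ⟨_, _, h.of_ringEquiv (RingEquiv.ofBijective e he)⟩

theorem exists_isFrobeniusForm_of_forall_eq_zero
    (hw : ∀ g k, w (g * k) = w g ᵥ* (A k).1 + (A g).1.det⁻¹ • w k)
    (hirr : ∀ v : Fin 2 → ZMod p, v ≠ 0 → ∃ g, (Matrix.of ![v, v ᵥ* (A g).1]).det ≠ 0)
    (hker : ∀ g, A g = 1 → w g = 0) :
    ∃ (φ : MvPolynomial (Fin 3) (ZMod p) →+*
        invariantAlg (Set.range fun g => affineMat (A g).1 (w g))) (τ : _ →+ _),
      IsFrobeniusForm φ τ := by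
  have hirr' : ∀ v : Fin 2 → ZMod p, v ≠ 0 → ∃ h ∈ A.range, (Matrix.of ![v, v ᵥ* h.1]).det ≠ 0 :=
    fun v hv => by
      obtain ⟨g, hg⟩ := hirr v hv
      exact ⟨_, ⟨g, rfl⟩, hg⟩
  have hw_eq : ∀ g k, A g = A k → w g = w k := fun g k h => by
    have h1 : A (g * k⁻¹) = 1 := by rw [_root_.map_mul, map_inv, h, mul_inv_cancel]
    have h2 := hw (g * k⁻¹) k
    rw [hker _ h1, h1] at h2
    simpa using h2
  choose l hl using fun h : A.range => h.2
  obtain ⟨v, hv⟩ := exists_coboundary (W := fun h => w (l h)) hirr' fun h k => by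
    have : w (l (h * k)) = w (l h * l k) := hw_eq _ _ (by rw [_root_.map_mul, hl, hl, hl]; rfl)
    rw [this, hw, hl, hl]
  have hwv : ∀ g, w g = (A g).1.det⁻¹ • v - v ᵥ* (A g).1 := fun g => by
    rw [← hv ⟨A g, g, rfl⟩]
    exact hw_eq _ _ (hl ⟨A g, g, rfl⟩).symm
  have hconj : (fun g => affineMat (A g).1 (w g))
      = fun g => affineMat 1 (-v) * affineMat (A g).1 0 * affineMat 1 v := by
    funext g
    rw [affineMat_mul, affineMat_mul, hwv]
    congr 1
    · simp
    · simp [neg_vecMul]; abel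
  have hinv : blockInv A.range = invariantAlg (Set.range fun g => affineMat (A g).1 0) := by
    ext f
    constructor
    · rintro hf _ ⟨g, rfl⟩
      dsimp only
      rw [polyAct_affineMat_zero]
      exact hf _ ⟨g, rfl⟩
    · rintro hf _ ⟨g, rfl⟩
      rw [← polyAct_affineMat_zero]
      exact hf _ ⟨g, rfl⟩
  have hF := exists_isFrobeniusForm_blockInv A.range hirr'
  rw [hinv] at hF
  obtain ⟨φ, τ, h⟩ := hF
  rw [hconj]
  have hm : ∀ a b : Fin 2 → ZMod p, a + b = 0 → affineMat 1 a * affineMat 1 b = 1 :=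
    fun a b hab => by
      rw [affineMat_mul, ← affineMat_one_zero]
      simp [hab]
  exact ⟨_, _, h.of_ringEquiv (invariantAlgConj _ (hm _ _ (by simp)) (hm _ _ (by simp)))⟩

theorem exists_isFrobeniusForm_affineMat
    (hw : ∀ g k, w (g * k) = w g ᵥ* (A k).1 + (A g).1.det⁻¹ • w k)
    (hirr : ∀ v : Fin 2 → ZMod p, v ≠ 0 → ∃ g, (Matrix.of ![v, v ᵥ* (A g).1]).det ≠ 0) :
    ∃ (φ : MvPolynomial (Fin 3) (ZMod p) →+*
        invariantAlg (Set.range fun g => affineMat (A g).1 (w g))) (τ : _ →+ _),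
      IsFrobeniusForm φ τ := by
  by_cases hker : ∀ g, A g = 1 → w g = 0
  · exact exists_isFrobeniusForm_of_forall_eq_zero hw hirr hker
  push Not at hker
  obtain ⟨g, hg, hg0⟩ := hker
  refine exists_isFrobeniusForm_of_forall_translation hw hirr fun u => ?_
  have hw1 : w 1 = 0 := by simpa using hw 1 1
  let Λ : AddSubgroup (Fin 2 → ZMod p) :=
    { carrier := {u | ∃ g, A g = 1 ∧ w g = u}
      zero_mem' := ⟨1, map_one A, hw1⟩
      add_mem' := by
        rintro _ _ ⟨g, hg, rfl⟩ ⟨k, hk, rfl⟩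
        exact ⟨g * k, by simp [hg, hk], by simp [hw, hg, hk]⟩
      neg_mem' := by
        rintro _ ⟨g, hg, rfl⟩
        refine ⟨g⁻¹, by simp [hg], ?_⟩
        have := hw g g⁻¹
        rw [mul_inv_cancel, hw1, map_inv, hg] at this
        simpa [eq_comm, eq_neg_iff_add_eq_zero, add_comm] using this }
  obtain ⟨k, hk⟩ := hirr _ hg0
  set M := Matrix.of ![w g, w g ᵥ* (A k).1] with hM
  have h0 : w g ∈ Λ := ⟨g, hg, rfl⟩
  have h1 : (A k).1.det • (w g ᵥ* (A k).1) ∈ Λ := by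
    refine ⟨k⁻¹ * (g * k), by simp [hg], ?_⟩
    have h2 := hw k⁻¹ k
    rw [inv_mul_cancel, hw1] at h2
    have h3 : (A k⁻¹).1.det⁻¹ = (A k).1.det := by
      have : (A k⁻¹).1 * (A k).1 = 1 := by
        rw [← Units.val_mul, ← _root_.map_mul, inv_mul_cancel, map_one, Units.val_one]
      have := congrArg det this
      rw [det_mul, det_one] at this
      rw [eq_inv_of_mul_eq_one_left this, inv_inv]
    rw [hw, _root_.map_mul, hg, one_mul, hw g k, hg, h3, smul_add]
    rw [h3] at h2
    simp only [Units.val_one, det_one, inv_one, one_smul]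
    rw [add_left_comm, ← h2, add_zero]
  have h2 : w g ᵥ* (A k).1 ∈ Λ := by
    have := ZMod.smul_mem (K := Λ) h1 ((A k).1.det⁻¹)
    rwa [smul_smul, inv_mul_cancel₀ (det_coe_ne_zero _), one_smul] at this
  have hu : u = (u ᵥ* M⁻¹) 0 • w g + (u ᵥ* M⁻¹) 1 • (w g ᵥ* (A k).1) := by
    have : u = (u ᵥ* M⁻¹) ᵥ* M := by
      rw [vecMul_vecMul, nonsing_inv_mul _ hk.isUnit, vecMul_one]
    nth_rewrite 1 [this]
    ext i
    simp [vecMul, dotProduct, Fin.sum_univ_two, hM]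
  have : u ∈ Λ := hu ▸ add_mem (ZMod.smul_mem h0 _) (ZMod.smul_mem h2 _)
  exact this

end Affine

section PlaneStabilizer

variable {p : ℕ} [Fact p.Prime]

theorem exists_smul_eq_of_det_eq_zero {F : Type*} [Field F] {v u : Fin 2 → F} (hv : v ≠ 0)
    (h : (Matrix.of ![v, u]).det = 0) : ∃ c : F, u = c • v := by
  have h' : v 0 * u 1 = v 1 * u 0 := by
    simpa [det_fin_two, sub_eq_zero] using h
  by_cases h0 : v 0 = 0
  · have h1 : v 1 ≠ 0 := fun h1 => hv (by ext i; fin_cases i <;> simp [h0, h1])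
    refine ⟨u 1 / v 1, ?_⟩
    have : u 0 = 0 := by simpa [h0, h1, eq_comm] using h'
    ext i
    fin_cases i <;> simp [h0, h1, this]
  · refine ⟨u 0 / v 0, ?_⟩
    ext i
    fin_cases i
    · simp [h0]
    · have : u 1 = u 0 * v 1 / v 0 := by rw [eq_div_iff h0]; linear_combination h'
      simp only [Fin.mk_one, this, Pi.smul_apply, smul_eq_mul]
      ring

/-- A matrix of determinant one whose first two rows vanish in the last column. -/
theorem eq_affineMat {D : Matrix (Fin 3) (Fin 3) (ZMod p)} (hdet : D.det = 1) (h0 : D 0 2 = 0)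
    (h1 : D 1 2 = 0) :
    D = affineMat !![D 0 0, D 0 1; D 1 0, D 1 1] ![D 2 0, D 2 1] := by
  have h2 : D 2 2 = (D 0 0 * D 1 1 - D 0 1 * D 1 0)⁻¹ := by
    apply eq_inv_of_mul_eq_one_left
    rw [det_fin_three, h0, h1] at hdet
    linear_combination hdet
  ext i j
  fin_cases i <;> fin_cases j <;> simp [affineMat, det_fin_two, h0, h1, h2]

theorem exists_basis_extension (W : Submodule (ZMod p) (Fin 3 → ZMod p))
    (hdimW : Module.finrank (ZMod p) W = 2) :
    ∃ P : Matrix (Fin 3) (Fin 3) (ZMod p), IsUnit P.det ∧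
      ∀ x, x ∈ W ↔ ∃ v : Fin 2 → ZMod p, x = ![v 0, v 1, 0] ᵥ* P := by
  let b := Module.finBasisOfFinrankEq (ZMod p) W hdimW
  obtain ⟨z, -, hz⟩ : ∃ z ∈ (⊤ : Submodule (ZMod p) (Fin 3 → ZMod p)), z ∉ W := by
    refine SetLike.exists_of_lt (lt_top_iff_ne_top.2 fun h => ?_)
    rw [h, finrank_top] at hdimW
    simp at hdimW
  have hrow : ∀ v : Fin 2 → ZMod p, ![v 0, v 1, 0] ᵥ* Matrix.of ![(b 0).1, (b 1).1, z]
      = v 0 • (b 0).1 + v 1 • (b 1).1 := fun v => by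
    ext i
    simp [vecMul, dotProduct, Fin.sum_univ_three]
  refine ⟨Matrix.of ![(b 0).1, (b 1).1, z], ?_, fun x => ?_⟩
  · rw [← isUnit_iff_isUnit_det, ← linearIndependent_rows_iff_isUnit]
    have hb : LinearIndependent (ZMod p) (fun i => (b i).1) :=
      b.linearIndependent.map' W.subtype W.ker_subtype
    have hspan : Submodule.span (ZMod p) (Set.range fun i => (b i).1) ≤ W :=
      Submodule.span_le.2 (by rintro _ ⟨i, rfl⟩; exact (b i).2)
    have := linearIndependent_finSnoc.2 ⟨hb, fun h => hz (hspan h)⟩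
    have hsnoc : (Matrix.of ![(b 0).1, (b 1).1, z]).row = Fin.snoc (fun i => (b i).1) z := by
      funext i
      fin_cases i <;> rfl
    rwa [hsnoc]
  · constructor
    · intro hx
      refine ⟨b.repr ⟨x, hx⟩, ?_⟩
      rw [hrow]
      have := congrArg Subtype.val (b.sum_repr ⟨x, hx⟩)
      rw [Fin.sum_univ_two] at this
      exact this.symm
    · rintro ⟨v, rfl⟩
      rw [hrow]
      exact add_mem (W.smul_mem _ (b 0).2) (W.smul_mem _ (b 1).2)

theorem exists_isFrobeniusForm_of_plane (G : Subgroup (SpecialLinearGroup (Fin 3) (ZMod p)))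
    (W : Submodule (ZMod p) (Fin 3 → ZMod p)) (hdimW : Module.finrank (ZMod p) W = 2)
    (hWG : ∀ g ∈ G, ∀ x ∈ W, x ᵥ* (g : Matrix (Fin 3) (Fin 3) (ZMod p)) ∈ W)
    (hirr : ∀ U : Submodule (ZMod p) (Fin 3 → ZMod p), U ≤ W →
      (∀ g ∈ G, ∀ x ∈ U, x ᵥ* (g : Matrix (Fin 3) (Fin 3) (ZMod p)) ∈ U) →
      U = ⊥ ∨ U = W) :
    ∃ (φ : MvPolynomial (Fin 3) (ZMod p) →+* invariantRing G) (τ : _ →+ _),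
      IsFrobeniusForm φ τ := by
  obtain ⟨P, hP, hPW⟩ := exists_basis_extension W hdimW
  have hPP : P * P⁻¹ = 1 := mul_nonsing_inv _ hP
  have hPP' : P⁻¹ * P = 1 := nonsing_inv_mul _ hP
  let D : G → Matrix (Fin 3) (Fin 3) (ZMod p) := fun g => P * g.1.1 * P⁻¹
  have hDP : ∀ g x, x ᵥ* D g ᵥ* P = x ᵥ* P ᵥ* g.1.1 := fun g x => by
    simp only [D, vecMul_vecMul, mul_assoc, hPP', mul_one]
  have hDmul : ∀ g k, D (g * k) = D g * D k := fun g k => by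
    have : (g * k).1.1 = g.1.1 * k.1.1 := rfl
    simp only [D, this, mul_assoc]
    rw [← mul_assoc P⁻¹ P, hPP', one_mul]
  have hD1 : D 1 = 1 := by
    have : (1 : G).1.1 = 1 := rfl
    simp only [D, this, mul_one, hPP]
  have hDdet : ∀ g, (D g).det = 1 := fun g => by
    have : g.1.1.det = 1 := g.1.2
    simp only [D, det_mul, this, mul_one]
    rw [← det_mul, hPP, det_one]
  have hinj : Function.Injective fun x : Fin 3 → ZMod p => x ᵥ* P :=
    vecMul_injective_of_isUnit ((isUnit_iff_isUnit_det P).2 hP)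
  have hstab : ∀ g (v : Fin 2 → ZMod p), (![v 0, v 1, 0] ᵥ* D g) 2 = 0 := fun g v => by
    obtain ⟨u, hu⟩ := (hPW _).1 (hWG g.1 g.2 _ ((hPW _).2 ⟨v, rfl⟩))
    rw [← hDP] at hu
    rw [hinj hu]
    simp
  have h0 : ∀ g, D g 0 2 = 0 := fun g => by
    simpa [vecMul, dotProduct, Fin.sum_univ_three] using hstab g ![1, 0]
  have h1 : ∀ g, D g 1 2 = 0 := fun g => by
    simpa [vecMul, dotProduct, Fin.sum_univ_three] using hstab g ![0, 1]
  let B : G →* Matrix (Fin 2) (Fin 2) (ZMod p) :=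
    { toFun := fun g => !![D g 0 0, D g 0 1; D g 1 0, D g 1 1]
      map_one' := by rw [hD1]; ext i j; fin_cases i <;> fin_cases j <;> simp
      map_mul' := fun g k => by
        rw [hDmul]
        ext i j
        fin_cases i <;> fin_cases j <;>
          simp [Matrix.mul_apply, Fin.sum_univ_three, Fin.sum_univ_two, h0, h1] }
  let A : G →* GL (Fin 2) (ZMod p) := B.toHomUnits
  let w : G → Fin 2 → ZMod p := fun g => ![D g 2 0, D g 2 1]
  have hDA : ∀ g, D g = affineMat (A g).1 (w g) := fun g => eq_affineMat (hDdet g) (h0 g) (h1 g)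
  have hw : ∀ g k, w (g * k) = w g ᵥ* (A k).1 + (A g).1.det⁻¹ • w k := fun g k => by
    have h := hDmul g k
    rw [hDA, hDA g, hDA k, affineMat_mul] at h
    ext i
    fin_cases i
    · exact congrFun (congrFun h 2) 0
    · exact congrFun (congrFun h 2) 1
  have hA : ∀ v : Fin 2 → ZMod p, v ≠ 0 → ∃ g, (Matrix.of ![v, v ᵥ* (A g).1]).det ≠ 0 := by
    intro v hv
    by_contra! hdet
    set x := ![v 0, v 1, 0] ᵥ* P with hx
    have hx0 : x ≠ 0 := fun h => hv <| by
      have := hinj (h.trans (zero_vecMul P).symm)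
      ext i
      fin_cases i
      · exact congrFun this 0
      · exact congrFun this 1
    have hvA : ∀ g, ![v 0, v 1, 0] ᵥ* D g = ![(v ᵥ* (A g).1) 0, (v ᵥ* (A g).1) 1, 0] := fun g => by
      rw [hDA]
      ext i
      fin_cases i <;> simp [affineMat, vecMul, dotProduct, Fin.sum_univ_three, Fin.sum_univ_two]
    have hxg : ∀ g : G, ∃ c : ZMod p, x ᵥ* g.1.1 = c • x := fun g => by
      obtain ⟨c, hc⟩ := exists_smul_eq_of_det_eq_zero hv (hdet g)
      refine ⟨c, ?_⟩
      rw [hx, ← hDP, hvA, hc, ← smul_vecMul]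
      simp
    have hfin := finrank_span_singleton (K := ZMod p) hx0
    rcases hirr (Submodule.span (ZMod p) {x})
      ((Submodule.span_singleton_le_iff_mem _ _).2 ((hPW x).2 ⟨v, hx⟩)) (fun g hg y hy => by
        obtain ⟨a, rfl⟩ := Submodule.mem_span_singleton.1 hy
        obtain ⟨c, hc⟩ := hxg ⟨g, hg⟩
        have hc : x ᵥ* (g : Matrix (Fin 3) (Fin 3) (ZMod p)) = c • x := hc
        rw [smul_vecMul, hc]
        exact Submodule.smul_mem _ _ (Submodule.smul_mem _ _
          (Submodule.mem_span_singleton_self x))) with h | h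
    · exact hx0 (Submodule.span_singleton_eq_bot.1 h)
    · rw [h, hdimW] at hfin
      omega
  have hG : invariantRing G = invariantAlg (Set.range fun g : G => g.1.1) := by
    rw [invariantRing]
    congr 1
    ext M
    simp
  have hF := exists_isFrobeniusForm_affineMat hw hA
  rw [← funext hDA] at hF
  obtain ⟨φ, τ, h⟩ := hF
  rw [hG]
  exact ⟨_, _, h.of_ringEquiv (invariantAlgConj (fun g : G => g.1.1) hPP' hPP).symm⟩

end PlaneStabilizer

/-- If `G ⊆ SL(3, 𝔽_p)` and `W ⊆ V = 𝔽_p³` is a 2-dimensional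
`G`-submodule which is irreducible as a `G`-module, then `S(V)^G` is Gorenstein. -/
theorem stmt16 (p : ℕ) [Fact p.Prime]
    (G : Subgroup (Matrix.SpecialLinearGroup (Fin 3) (ZMod p)))
    (W : Submodule (ZMod p) (Fin 3 → ZMod p)) (hdimW : Module.finrank (ZMod p) W = 2)
    (hWG : ∀ g ∈ G, ∀ x ∈ W, x ᵥ* (g : Matrix (Fin 3) (Fin 3) (ZMod p)) ∈ W)
    (hirr : ∀ U : Submodule (ZMod p) (Fin 3 → ZMod p), U ≤ W →
      (∀ g ∈ G, ∀ x ∈ U, x ᵥ* (g : Matrix (Fin 3) (Fin 3) (ZMod p)) ∈ U) →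
      U = ⊥ ∨ U = W) :
    IsGorensteinRing ↥(invariantRing G) := by
  obtain ⟨φ, τ, h⟩ := exists_isFrobeniusForm_of_plane G W hdimW hWG hirr
  exact h.isGorensteinRing

end
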